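/- Consider a scaling (K_{1,n}, …, K_{r,n}, P_n, α_n) such that Λ_1(n) = c_n · (log n)/n for every n, where c_n → c and c > 1. Assume in addition that there exists σ > 0 with P_n ≥ σ·n for all n, and that n · α_n · p_{11}(n) → ∞ as n → ∞. Then the probability that the random graph G(n; μ, K_n, P_n, α_n) is connected tends to 1 as n → ∞. -/

import Mathlib

open Filter Real

noncomputable section

namespace HetKey

/-- The set of ordered index pairs `x < y` (one Bernoulli coin per unordered pair). -/
abbrev Pairs (n : ℕ) : Type := {p : Fin n × Fin n // p.1 < p.2}

/-- A configuration of the randomness: the class of each vertex, the key ring of each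
vertex (a subset of the key pool `{1,…,P}`), and the Bernoulli link coins. -/
abbrev Config (n r P : ℕ) : Type :=
  (Fin n → Fin r) × (Fin n → Finset (Fin P)) × (Pairs n → Bool)

/-- Weight of a key ring under the uniform distribution on `k`-subsets of the pool. -/
def keyWeight (P k : ℕ) (s : Finset (Fin P)) : ℝ :=
  if s.card = k then ((P.choose k : ℝ))⁻¹ else 0

/-- Probability weight of a configuration: classes are i.i.d. with law `μ`, key rings are
(conditionally) uniform `K (class)`-subsets, link coins are i.i.d. Bernoulli(`α`). -/
def weight {n r P : ℕ} (μ : Fin r → ℝ) (K : Fin r → ℕ) (α : ℝ)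
    (cfg : Config n r P) : ℝ :=
  (∏ x, μ (cfg.1 x) * keyWeight P (K (cfg.1 x)) (cfg.2.1 x)) *
    ∏ p, (if cfg.2.2 p then α else 1 - α)

open scoped Classical in
/-- Probability of an event in `G(n; μ, K, P, α)`. -/
def Pr {n r P : ℕ} (μ : Fin r → ℝ) (K : Fin r → ℕ) (α : ℝ)
    (E : Config n r P → Prop) : ℝ :=
  ∑ cfg, if E cfg then weight μ K α cfg else 0

/-- Expectation of a random variable on the configuration space. -/
def expect {n r P : ℕ} (μ : Fin r → ℝ) (K : Fin r → ℕ) (α : ℝ)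
    (X : Config n r P → ℝ) : ℝ :=
  ∑ cfg, weight μ K α cfg * X cfg

/-- The Bernoulli coin attached to the unordered pair `{x, y}`. -/
def coin {n : ℕ} (b : Pairs n → Bool) (x y : Fin n) : Bool :=
  if h : x < y then b ⟨(x, y), h⟩
  else if h' : y < x then b ⟨(y, x), h'⟩
  else false

/-- Adjacency in `G(n; μ, K, P, α)`: distinct vertices, intersecting key rings, and an
operational (non-failed) link. -/
def adj {n r P : ℕ} (cfg : Config n r P) (x y : Fin n) : Prop :=
  x ≠ y ∧ (cfg.2.1 x ∩ cfg.2.1 y).Nonempty ∧ coin cfg.2.2 x y = true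

/-- A vertex is isolated if it has no neighbours. -/
def isolated {n r P : ℕ} (cfg : Config n r P) (x : Fin n) : Prop :=
  ∀ y, ¬ adj cfg x y

/-- Connectivity: every pair of vertices is joined by a path. -/
def conn {n r P : ℕ} (cfg : Config n r P) : Prop :=
  ∀ x y : Fin n, Relation.ReflTransGen (adj cfg) x y

/-- `p_{ij}`: the probability that a uniform `K_i`-subset and an independent uniform
`K_j`-subset of a pool of size `P` intersect. -/
def pEdge (P Ki Kj : ℕ) : ℝ :=
  1 - ((P - Ki).choose Kj : ℝ) / (P.choose Kj : ℝ)

/-- `λ_i = Σ_j μ_j p_{ij}`. -/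
def lam {r : ℕ} (μ : Fin r → ℝ) (K : Fin r → ℕ) (P : ℕ) (i : Fin r) : ℝ :=
  ∑ j, μ j * pEdge P (K i) (K j)

/-- `Λ_i = α λ_i`. -/
def Lam {r : ℕ} (μ : Fin r → ℝ) (K : Fin r → ℕ) (P : ℕ) (α : ℝ) (i : Fin r) : ℝ :=
  α * lam μ K P i

end HetKey

open HetKey

namespace HetKey

/-! ### Binomial estimates -/

lemma choose_mul_choose_le (P K a b : ℕ) :
    (P - (a + b)).choose K * P.choose K ≤ (P - a).choose K * (P - b).choose K := by
  have h : (P - (a + b)).descFactorial K * P.descFactorial K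
      ≤ (P - a).descFactorial K * (P - b).descFactorial K := by
    simp only [Nat.descFactorial_eq_prod_range, ← Finset.prod_mul_distrib]
    refine Finset.prod_le_prod' fun i _ => ?_
    rcases le_total P (a + b + i) with h | h
    · rw [show P - (a + b) - i = 0 by omega]; simp
    · obtain ⟨d, rfl⟩ := Nat.exists_eq_add_of_le h
      rw [show a + b + i + d - (a + b) - i = d by omega,
        show a + b + i + d - i = a + b + d by omega,
        show a + b + i + d - a - i = b + d by omega, show a + b + i + d - b - i = a + d by omega]
      nlinarith [Nat.zero_le (a * b)]
  simp only [Nat.descFactorial_eq_factorial_mul_choose] at h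
  have hK := Nat.factorial_pos K
  have : K.factorial * K.factorial * ((P - (a + b)).choose K * P.choose K)
      ≤ K.factorial * K.factorial * ((P - a).choose K * (P - b).choose K) := by
    calc _ = K.factorial * (P - (a + b)).choose K * (K.factorial * P.choose K) := by ring
      _ ≤ _ := h
      _ = _ := by ring
  exact Nat.le_of_mul_le_mul_left this (by positivity)

lemma choose_mul_pow_le {w P : ℕ} (K : ℕ) (h : w ≤ P) :
    w.choose K * P ^ K ≤ P.choose K * w ^ K := by
  have h : w.descFactorial K * P ^ K ≤ P.descFactorial K * w ^ K := by
    have hpow : ∀ x : ℕ, x ^ K = ∏ _i ∈ Finset.range K, x := by simp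
    rw [hpow P, hpow w, Nat.descFactorial_eq_prod_range, Nat.descFactorial_eq_prod_range,
      ← Finset.prod_mul_distrib, ← Finset.prod_mul_distrib]
    refine Finset.prod_le_prod' fun i _ => ?_
    rcases le_total w i with hi | hi
    · rw [show w - i = 0 by omega]; simp
    · obtain ⟨d, rfl⟩ := Nat.exists_eq_add_of_le hi
      obtain ⟨e, rfl⟩ := Nat.exists_eq_add_of_le h
      rw [show i + d - i = d by omega, show i + d + e - i = d + e by omega]
      nlinarith [Nat.zero_le (i * e)]
  simp only [Nat.descFactorial_eq_factorial_mul_choose] at h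
  refine Nat.le_of_mul_le_mul_left ?_ (Nat.factorial_pos K)
  calc _ = K.factorial * w.choose K * P ^ K := by ring
    _ ≤ _ := h
    _ = _ := by ring

lemma choose_ratio_le {w P K : ℕ} (h : w ≤ P) (hK : K ≤ P) :
    (w.choose K : ℝ) / P.choose K ≤ ((w : ℝ) / P) ^ K := by
  have hc : (0 : ℝ) < P.choose K := by exact_mod_cast Nat.choose_pos hK
  rcases Nat.eq_zero_or_pos P with rfl | hP
  · obtain rfl : w = 0 := by omega
    obtain rfl : K = 0 := by omega
    simp
  rw [div_pow, div_le_div_iff₀ hc (by positivity)]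
  have := choose_mul_pow_le K h
  rw [mul_comm ((w : ℝ) ^ K)]
  exact_mod_cast this

lemma one_sub_pEdge (P a K : ℕ) :
    1 - pEdge P a K = ((P - a).choose K : ℝ) / P.choose K := by
  simp [pEdge]

lemma pEdge_nonneg (P a K : ℕ) : 0 ≤ pEdge P a K := by
  rw [pEdge, sub_nonneg]
  refine div_le_one_of_le₀ ?_ (by positivity)
  exact_mod_cast Nat.choose_le_choose K (Nat.sub_le P a)

lemma pEdge_le_one (P a K : ℕ) : pEdge P a K ≤ 1 := by
  rw [pEdge, sub_le_self_iff]; positivity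

lemma one_sub_exp_le_pEdge {P a K : ℕ} (ha : a ≤ P) (hK : K ≤ P) :
    1 - exp (-((a : ℝ) * K / P)) ≤ pEdge P a K := by
  have h1 := choose_ratio_le (Nat.sub_le P a) hK
  have h2 : (((P - a : ℕ) : ℝ) / P) ^ K ≤ exp (-((a : ℝ) * K / P)) := by
    rcases Nat.eq_zero_or_pos P with rfl | hP
    · obtain rfl : K = 0 := by omega
      simp
    have : ((P - a : ℕ) : ℝ) / P ≤ exp (-((a : ℝ) / P)) := by
      refine le_trans (le_of_eq ?_) (one_sub_le_exp_neg _)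
      rw [Nat.cast_sub ha]; field_simp
    calc _ ≤ exp (-((a : ℝ) / P)) ^ K := by gcongr
      _ = _ := by rw [← exp_nat_mul]; ring_nf
  have := one_sub_pEdge P a K
  linarith

/-- The increments of `a ↦ pEdge P a K` decrease, whence `pEdge P a K / a` decreases. -/
lemma mul_pEdge_le {P K a b : ℕ} (hK : 1 ≤ K) (hab : a ≤ b) (hb : b ≤ P) :
    (a : ℝ) * pEdge P b K ≤ b * pEdge P a K := by
  obtain ⟨K, rfl⟩ := Nat.exists_eq_add_of_le' hK
  set C : ℝ := ((P.choose (K + 1) : ℕ) : ℝ) with hC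
  have hC0 : 0 ≤ C := by positivity
  have hinc : ∀ i, i < P → pEdge P (i + 1) (K + 1) - pEdge P i (K + 1)
      = ((P - (i + 1)).choose K : ℝ) / C := by
    intro i hi
    obtain ⟨d, hd⟩ : ∃ d, P - i = d + 1 := ⟨P - i - 1, by omega⟩
    rw [pEdge, pEdge, hd, show P - (i + 1) = d by omega, Nat.choose_succ_succ]
    push_cast
    ring
  by_cases hCz : C = 0
  · have : ∀ i, pEdge P i (K + 1) = 1 := by intro i; rw [pEdge, ← hC, hCz]; simp
    rw [this, this]; simpa using (by exact_mod_cast hab : (a : ℝ) ≤ b)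
  have h0 : pEdge P 0 (K + 1) = 0 := by
    rw [pEdge, Nat.sub_zero, ← hC, div_self hCz, sub_self]
  have hsum : ∀ i, i ≤ P → (i < P → (i : ℝ) * (((P - (i + 1)).choose K : ℝ) / C)
      ≤ pEdge P i (K + 1)) := by
    intro i
    induction i with
    | zero => intro _ _; simp [h0]
    | succ i ih =>
      intro hi hi'
      have h1 := ih (by omega) (by omega)
      have h2 := hinc i (by omega)
      have h3 : ((P - (i + 1 + 1)).choose K : ℝ) / C ≤ ((P - (i + 1)).choose K : ℝ) / C := by
        gcongr
        omega
      push_cast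
      have : (0 : ℝ) ≤ i + 1 := by positivity
      nlinarith [mul_le_mul_of_nonneg_left h3 this]
  induction b, hab using Nat.le_induction with
  | base => exact le_refl _
  | succ b hab ih =>
    have h1 := ih (by omega)
    have h2 := hsum b (by omega) (by omega)
    have h3 := hinc b (by omega)
    have hb0 : (0 : ℝ) ≤ b := by positivity
    rcases Nat.eq_zero_or_pos b with rfl | hbp
    · obtain rfl : a = 0 := by omega
      simp [h0]
    have hb1 : (0 : ℝ) < b := by exact_mod_cast hbp
    have h4 : (b : ℝ) * pEdge P (b + 1) (K + 1) ≤ (b + 1) * pEdge P b (K + 1) := by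
      nlinarith
    have ha0 : (0 : ℝ) ≤ a := by positivity
    push_cast
    have h5 := mul_le_mul_of_nonneg_left h4 ha0
    have h6 : (b : ℝ) * (a * pEdge P (b + 1) (K + 1))
        ≤ b * ((b + 1) * pEdge P a (K + 1)) := by
      nlinarith
    exact le_of_mul_le_mul_left h6 hb1

lemma pEdge_le_mul_div {P K b : ℕ} (hK : 1 ≤ K) (hKP : K ≤ P) (hb : b ≤ P) :
    pEdge P b K ≤ (b : ℝ) * K / P := by
  rcases Nat.eq_zero_or_pos b with rfl | hb1
  · have : (0 : ℝ) < P.choose K := by exact_mod_cast Nat.choose_pos hKP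
    simp [pEdge, div_self this.ne']
  have h := mul_pEdge_le (a := 1) hK hb1 hb
  have h1 : pEdge P 1 K = (K : ℝ) / P := by
    obtain ⟨Q, rfl⟩ := Nat.exists_eq_add_of_le' (show 1 ≤ P by omega)
    have hc : (0 : ℝ) < (Q + 1).choose K := by exact_mod_cast Nat.choose_pos hKP
    have h2 := Nat.choose_mul_succ_eq Q K
    have h3 : ((Q.choose K : ℝ)) * (Q + 1) = (Q + 1).choose K * (Q + 1 - K) := by
      rw [← Nat.cast_succ, ← Nat.cast_sub hKP]; exact_mod_cast h2
    rw [pEdge, Nat.add_sub_cancel]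
    push_cast
    field_simp
    linarith
  rw [h1] at h
  calc _ ≤ _ := by simpa using h
    _ = _ := by ring

/-! ### Uniform key rings -/

lemma keyWeight_nonneg (P k : ℕ) (s : Finset (Fin P)) : 0 ≤ keyWeight P k s := by
  unfold keyWeight; split_ifs <;> positivity

lemma sum_keyWeight_mul (P k : ℕ) (f : Finset (Fin P) → ℝ) :
    ∑ s, keyWeight P k s * f s
      = (P.choose k : ℝ)⁻¹ * ∑ s ∈ Finset.powersetCard k Finset.univ, f s := by
  have h : Finset.powersetCard k (Finset.univ : Finset (Fin P))
      = Finset.univ.filter fun s => s.card = k := by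
    ext s; simp [Finset.mem_powersetCard]
  rw [Finset.mul_sum, h, Finset.sum_filter]
  refine Finset.sum_congr rfl fun s _ => ?_
  unfold keyWeight; split_ifs <;> simp

lemma sum_keyWeight_subset (P k : ℕ) (W : Finset (Fin P)) :
    ∑ s, keyWeight P k s * (if s ⊆ W then 1 else 0) = (W.card.choose k : ℝ) / P.choose k := by
  rw [sum_keyWeight_mul, Finset.sum_boole, inv_mul_eq_div]
  congr 2
  rw [← Finset.card_powersetCard]
  congr 1
  ext s
  simp [Finset.mem_powersetCard, and_comm]

lemma sum_keyWeight {P k : ℕ} (h : k ≤ P) : ∑ s, keyWeight P k s = 1 := by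
  have := sum_keyWeight_subset P k Finset.univ
  have hc : (0 : ℝ) < P.choose k := by exact_mod_cast Nat.choose_pos h
  simpa [hc.ne'] using this

lemma sum_keyWeight_disjoint (P k : ℕ) (A : Finset (Fin P)) :
    ∑ s, keyWeight P k s * (if Disjoint A s then 1 else 0) = 1 - pEdge P A.card k := by
  have := sum_keyWeight_subset P k Aᶜ
  rw [Finset.card_compl, Fintype.card_fin] at this
  rw [one_sub_pEdge, ← this]
  refine Finset.sum_congr rfl fun s _ => ?_
  simp only [Finset.subset_compl_iff_disjoint_left]

/-- Averages of decreasing functions over uniform `k`-subsets decrease with `k`. -/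
lemma sum_keyWeight_antitone {P k K : ℕ} (hkK : k ≤ K) (hK : K ≤ P)
    {f : Finset (Fin P) → ℝ} (hf : Antitone f) :
    ∑ s, keyWeight P K s * f s ≤ ∑ s, keyWeight P k s * f s := by
  induction K, hkK using Nat.le_induction with
  | base => exact le_refl _
  | succ K hkK ih =>
    refine le_trans ?_ (ih (by omega))
    rw [sum_keyWeight_mul, sum_keyWeight_mul]
    have hc : (0 : ℝ) < P.choose K := by exact_mod_cast Nat.choose_pos (by omega : K ≤ P)
    have hc' : (0 : ℝ) < P.choose (K + 1) := by exact_mod_cast Nat.choose_pos hK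
    have hrel : (P.choose (K + 1) : ℝ) * (K + 1) = P.choose K * (P - K : ℕ) := by
      exact_mod_cast Nat.choose_succ_right_eq P K
    have hcount : ((K : ℝ) + 1) * ∑ s ∈ Finset.powersetCard (K + 1) Finset.univ, f s
        ≤ (P - K : ℕ) * ∑ s ∈ Finset.powersetCard K (Finset.univ : Finset (Fin P)), f s := by
      have h1 : ((K : ℝ) + 1) * ∑ s ∈ Finset.powersetCard (K + 1) Finset.univ, f s
          ≤ ∑ s ∈ Finset.powersetCard (K + 1) (Finset.univ : Finset (Fin P)),
              ∑ x ∈ s, f (s.erase x) := by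
        rw [Finset.mul_sum]
        refine Finset.sum_le_sum fun s hs => ?_
        have hs' := (Finset.mem_powersetCard.mp hs).2
        calc _ = ∑ _x ∈ s, f s := by simp [hs']
          _ ≤ _ := Finset.sum_le_sum fun x _ => hf (Finset.erase_subset x s)
      have h2 : ∑ s ∈ Finset.powersetCard (K + 1) (Finset.univ : Finset (Fin P)),
              ∑ x ∈ s, f (s.erase x)
          = ∑ s ∈ Finset.powersetCard K (Finset.univ : Finset (Fin P)), ∑ x ∈ sᶜ, f s := by
        rw [Finset.sum_sigma', Finset.sum_sigma']
        refine Finset.sum_bij' (fun p _ => ⟨p.1.erase p.2, p.2⟩)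
          (fun p _ => ⟨insert p.2 p.1, p.2⟩) ?_ ?_ ?_ ?_ ?_
        · rintro ⟨s, x⟩ h
          simp only [Finset.mem_sigma, Finset.mem_powersetCard_univ] at h ⊢
          simp [Finset.card_erase_of_mem h.2, h.1]
        · rintro ⟨s, x⟩ h
          simp only [Finset.mem_sigma, Finset.mem_powersetCard_univ, Finset.mem_compl] at h ⊢
          simp [Finset.card_insert_of_notMem h.2, h.1]
        · rintro ⟨s, x⟩ h
          simp only [Finset.mem_sigma] at h
          simp [Finset.insert_erase h.2]
        · rintro ⟨s, x⟩ h
          simp only [Finset.mem_sigma, Finset.mem_compl] at h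
          simp [Finset.erase_insert h.2]
        · rintro ⟨s, x⟩ h
          rfl
      have h3 : ∑ s ∈ Finset.powersetCard K (Finset.univ : Finset (Fin P)), ∑ x ∈ sᶜ, f s
          = (P - K : ℕ) * ∑ s ∈ Finset.powersetCard K (Finset.univ : Finset (Fin P)), f s := by
        rw [Finset.mul_sum]
        refine Finset.sum_congr rfl fun s hs => ?_
        have hs' := (Finset.mem_powersetCard.mp hs).2
        simp [Finset.card_compl, hs']
      linarith
    have hK0 : (0 : ℝ) < K + 1 := by positivity
    rw [inv_mul_le_iff₀ hc', ← mul_assoc]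
    refine le_of_mul_le_mul_left (hcount.trans (le_of_eq ?_)) hK0
    rw [← mul_assoc, ← mul_assoc, mul_comm _ (P.choose (K + 1) : ℝ), hrel]
    field_simp

/-! ### Product weights -/

lemma sum_pi_option {ι β : Type*} [Fintype ι] [DecidableEq ι] [Fintype β] (w : β → ℝ)
    (F : (Option ι → β) → ℝ) :
    ∑ σ : Option ι → β, (∏ i, w (σ i)) * F σ
      = ∑ b : β, w b * ∑ σ : ι → β, (∏ i, w (σ i)) *
          F ((Equiv.piOptionEquivProd (β := fun _ => β)).symm (b, σ)) := by
  rw [← Equiv.sum_comp (Equiv.piOptionEquivProd (β := fun _ : Option ι => β)).symm,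
    Fintype.sum_prod_type]
  refine Finset.sum_congr rfl fun b _ => ?_
  rw [Finset.mul_sum]
  refine Finset.sum_congr rfl fun σ _ => ?_
  rw [Fintype.prod_option, ← mul_assoc]
  rfl

/-- Stochastic domination of one-site weights passes to product weights. -/
lemma sum_prod_mul_le_of_antitone {β : Type*} [Fintype β] [Preorder β] {w₁ w₂ : β → ℝ}
    (h₁ : ∀ b, 0 ≤ w₁ b)
    (h₂ : ∀ b, 0 ≤ w₂ b) (h : ∀ f : β → ℝ, Antitone f → ∑ b, w₁ b * f b ≤ ∑ b, w₂ b * f b)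
    (ι : Type*) [Fintype ι] [DecidableEq ι] (F : (ι → β) → ℝ) (hF : Antitone F) :
    ∑ σ : ι → β, (∏ i, w₁ (σ i)) * F σ ≤ ∑ σ : ι → β, (∏ i, w₂ (σ i)) * F σ := by
  classical
  have key : ∀ (ι : Type _) [Fintype ι], ∀ (_ : DecidableEq ι) (F : (ι → β) → ℝ), Antitone F →
      ∑ σ : ι → β, (∏ i, w₁ (σ i)) * F σ ≤ ∑ σ : ι → β, (∏ i, w₂ (σ i)) * F σ := by
    refine Fintype.induction_empty_option ?_ ?_ ?_
    · intro α γ _ e ih _ F hF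
      have := Fintype.ofEquiv γ e.symm
      have h3 := ih (Classical.decEq _) (fun σ => F (σ ∘ e.symm))
        (fun a b hab => hF fun i => hab _)
      have tr : ∀ w : β → ℝ, ∑ σ : γ → β, (∏ i, w (σ i)) * F σ
          = ∑ σ : α → β, (∏ i, w (σ i)) * F (σ ∘ e.symm) := by
        intro w
        rw [← Equiv.sum_comp (e.arrowCongr (Equiv.refl β))]
        refine Finset.sum_congr rfl fun σ _ => ?_
        congr 1
        rw [← Equiv.prod_comp e]
        simp [Equiv.arrowCongr]
      rw [tr, tr]
      convert h3
    · intro _ F hF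
      simp
    · intro ι _ ih _ F hF
      have hmono : ∀ b : β, Antitone fun σ : ι → β =>
          F ((Equiv.piOptionEquivProd (β := fun _ => β)).symm (b, σ)) := by
        intro b σ τ hst
        refine hF fun i => ?_
        cases i with
        | none => exact le_refl _
        | some i => exact hst i
      have e : ∀ w : β → ℝ, ∑ σ : Option ι → β, (∏ i, w (σ i)) * F σ
          = ∑ b : β, w b * ∑ σ : ι → β, (∏ i, w (σ i)) *
            F ((Equiv.piOptionEquivProd (β := fun _ => β)).symm (b, σ)) := by
        intro w
        convert sum_pi_option w F
      rw [e w₁, e w₂]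
      calc _ ≤ ∑ b : β, w₁ b * ∑ σ : ι → β, (∏ i, w₂ (σ i)) *
          F ((Equiv.piOptionEquivProd (β := fun _ => β)).symm (b, σ)) := by
            refine Finset.sum_le_sum fun b _ => mul_le_mul_of_nonneg_left ?_ (h₁ b)
            exact ih (Classical.decEq _) _ (hmono b)
        _ ≤ ∑ b : β, w₂ b * ∑ σ : ι → β, (∏ i, w₂ (σ i)) *
          F ((Equiv.piOptionEquivProd (β := fun _ => β)).symm (b, σ)) := by
            refine h _ fun b c hbc => Finset.sum_le_sum fun σ _ =>
              mul_le_mul_of_nonneg_left (hF fun i => ?_) (Finset.prod_nonneg fun i _ => h₂ _)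
            cases i with
            | none => exact hbc
            | some i => exact le_refl _
  exact key ι _ F hF

/-! ### One block of key rings -/

/-- The probability that a link of reliability `a` between key rings `A` and `s` is absent. -/
def noLink {P : ℕ} (a : ℝ) (A s : Finset (Fin P)) : ℝ :=
  if (A ∩ s).Nonempty then 1 - a else 1

lemma noLink_nonneg {P : ℕ} {a : ℝ} (ha : a ≤ 1) (A s : Finset (Fin P)) : 0 ≤ noLink a A s := by
  unfold noLink; split_ifs <;> linarith

lemma noLink_le_one {P : ℕ} {a : ℝ} (ha : 0 ≤ a) (A s : Finset (Fin P)) : noLink a A s ≤ 1 := by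
  unfold noLink; split_ifs <;> linarith

lemma noLink_anti {P : ℕ} {a : ℝ} (ha : 0 ≤ a) {A B : Finset (Fin P)} (h : A ⊆ B)
    (s : Finset (Fin P)) : noLink a B s ≤ noLink a A s := by
  unfold noLink
  by_cases hA : (A ∩ s).Nonempty
  · rw [if_pos hA, if_pos (hA.mono (Finset.inter_subset_inter_right h))]
  · rw [if_neg hA]; split_ifs <;> linarith

lemma noLink_pow {P : ℕ} (a : ℝ) (A s : Finset (Fin P)) (g : ℕ) :
    noLink a A s ^ g = noLink (1 - (1 - a) ^ g) A s := by
  unfold noLink; split_ifs <;> simp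

lemma noLink_eq {P : ℕ} (a : ℝ) (A s : Finset (Fin P)) :
    noLink a A s = (1 - a) + a * (if Disjoint A s then 1 else 0) := by
  unfold noLink
  by_cases h : Disjoint A s
  · rw [if_neg (fun h' => Finset.not_disjoint_iff_nonempty_inter.mpr h' h), if_pos h]; ring
  · rw [if_pos (Finset.not_disjoint_iff_nonempty_inter.mp h), if_neg h]; ring

lemma one_sub_pEdge_add_le {P K : ℕ} (hK : K ≤ P) (a b : ℕ) :
    1 - pEdge P (a + b) K ≤ (1 - pEdge P a K) * (1 - pEdge P b K) := by
  have hc : (0 : ℝ) < P.choose K := by exact_mod_cast Nat.choose_pos hK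
  rw [one_sub_pEdge, one_sub_pEdge, one_sub_pEdge, div_mul_div_comm,
    div_le_div_iff₀ hc (by positivity)]
  have h := choose_mul_choose_le P K a b
  have h' : ((P - (a + b)).choose K : ℝ) * P.choose K
      ≤ (P - a).choose K * (P - b).choose K := by exact_mod_cast h
  nlinarith

lemma sum_keyWeight_noLink_disjoint {P K : ℕ} (hK : K ≤ P) {a : ℝ} (ha0 : 0 ≤ a) (ha1 : a ≤ 1)
    {ι : Type*} [DecidableEq ι] (I : Finset ι) (B : ι → Finset (Fin P))
    (hB : (I : Set ι).PairwiseDisjoint B) (F : Finset (Fin P)) (hF : ∀ i ∈ I, Disjoint F (B i)) :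
    ∑ s, keyWeight P K s * ((if Disjoint F s then 1 else 0) * ∏ i ∈ I, noLink a (B i) s)
      ≤ (1 - pEdge P F.card K) * ∏ i ∈ I, (1 - a * pEdge P (B i).card K) := by
  induction I using Finset.induction_on generalizing F with
  | empty => simp [← sum_keyWeight_disjoint P K F]
  | insert i I hi ih =>
    have hBI : (I : Set ι).PairwiseDisjoint B := hB.subset (by simp)
    have hprod : 0 ≤ ∏ i ∈ I, (1 - a * pEdge P (B i).card K) :=
      Finset.prod_nonneg fun j _ => by
        nlinarith [pEdge_nonneg P (B j).card K, pEdge_le_one P (B j).card K]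
    have h1 := ih hBI F fun j hj => hF j (Finset.mem_insert_of_mem hj)
    have h2 := ih hBI (F ∪ B i) fun j hj => by
      rw [Finset.disjoint_union_left]
      refine ⟨hF j (Finset.mem_insert_of_mem hj), hB (by simp) (by simp [hj]) ?_⟩
      rintro rfl; exact hi hj
    rw [Finset.card_union_of_disjoint (hF i (Finset.mem_insert_self i I))] at h2
    have hsplit : ∀ s : Finset (Fin P), keyWeight P K s *
        ((if Disjoint F s then 1 else 0) * ∏ j ∈ insert i I, noLink a (B j) s)
        = (1 - a) * (keyWeight P K s * ((if Disjoint F s then 1 else 0) *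
            ∏ j ∈ I, noLink a (B j) s))
          + a * (keyWeight P K s * ((if Disjoint (F ∪ B i) s then 1 else 0) *
            ∏ j ∈ I, noLink a (B j) s)) := by
      intro s
      rw [Finset.prod_insert hi, noLink_eq]
      by_cases hd1 : Disjoint F s <;> by_cases hd2 : Disjoint (B i) s <;>
        simp [hd1, hd2, Finset.disjoint_union_left] <;> ring
    simp only [hsplit, Finset.sum_add_distrib, ← Finset.mul_sum]
    rw [Finset.prod_insert hi]
    have h3 := one_sub_pEdge_add_le hK F.card (B i).card
    calc _ ≤ (1 - a) * ((1 - pEdge P F.card K) * ∏ i ∈ I, (1 - a * pEdge P (B i).card K))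
          + a * ((1 - pEdge P F.card K) * (1 - pEdge P (B i).card K) *
            ∏ i ∈ I, (1 - a * pEdge P (B i).card K)) := by
          refine add_le_add (mul_le_mul_of_nonneg_left h1 (by linarith))
            (mul_le_mul_of_nonneg_left (h2.trans ?_) ha0)
          exact mul_le_mul_of_nonneg_right h3 hprod
      _ = _ := by ring

/-- If key rings of size at most `k` jointly cover at least `U` keys, a fresh key ring of size `K`
misses all of them with probability at most `exp (-a U p / k)`. -/
lemma sum_keyWeight_noLink_le {P K k s : ℕ} (hK1 : 1 ≤ K) (hK : K ≤ P) (hk1 : 1 ≤ k) (hk : k ≤ P)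
    {a U : ℝ} (ha0 : 0 ≤ a) (ha1 : a ≤ 1) (A : Fin s → Finset (Fin P)) (hA : ∀ i, (A i).card ≤ k)
    (hU : U ≤ (Finset.univ.biUnion A).card) :
    ∑ x, keyWeight P K x * ∏ i, noLink a (A i) x ≤ exp (-(a * (U / k) * pEdge P k K)) := by
  set B : Fin s → Finset (Fin P) := disjointed A with hB
  have hBA : ∀ i, B i ⊆ A i := fun i => disjointed_le A i
  have hdisj : Pairwise (Function.onFun Disjoint B) := disjoint_disjointed A
  have hunion : Finset.univ.biUnion B = Finset.univ.biUnion A := by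
    rw [← Finset.sup_eq_biUnion, ← Finset.sup_eq_biUnion, hB, Fintype.sup_disjointed]
  have hcard : ((Finset.univ.biUnion A).card : ℝ) = ∑ i, ((B i).card : ℝ) := by
    rw [← hunion, Finset.card_biUnion fun i _ j _ hij => hdisj hij]
    push_cast; rfl
  have h1 := sum_keyWeight_noLink_disjoint hK ha0 ha1 Finset.univ B
    (fun i _ j _ hij => hdisj hij) ∅ (by simp)
  have h0 : pEdge P 0 K = 0 := by
    have hc : (0 : ℝ) < P.choose K := by exact_mod_cast Nat.choose_pos hK
    simp [pEdge, div_self hc.ne']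
  simp only [Finset.card_empty, h0, Finset.disjoint_empty_left, if_true, one_mul, sub_zero] at h1
  have hk0 : (0 : ℝ) < k := by exact_mod_cast hk1
  calc _ ≤ ∑ x, keyWeight P K x * ∏ i, noLink a (B i) x := by
        refine Finset.sum_le_sum fun x _ => mul_le_mul_of_nonneg_left ?_ (keyWeight_nonneg _ _ _)
        exact Finset.prod_le_prod (fun i _ => noLink_nonneg ha1 _ _)
          fun i _ => noLink_anti ha0 (hBA i) x
    _ ≤ ∏ i, (1 - a * pEdge P (B i).card K) := h1
    _ ≤ ∏ i, exp (-(a * ((B i).card / k * pEdge P k K))) := by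
        refine Finset.prod_le_prod (fun j _ => ?_) fun i _ => ?_
        · nlinarith [pEdge_nonneg P (B j).card K, pEdge_le_one P (B j).card K]
        · refine le_trans ?_ (one_sub_le_exp_neg _)
          have hle := mul_pEdge_le hK1 ((Finset.card_le_card (hBA i)).trans (hA i)) hk
          have : ((B i).card : ℝ) / k * pEdge P k K ≤ pEdge P (B i).card K := by
            rw [div_mul_eq_mul_div, div_le_iff₀ hk0]; linarith
          have := mul_le_mul_of_nonneg_left this ha0
          linarith
    _ = exp (-(a * ((∑ i, ((B i).card : ℝ)) / k) * pEdge P k K)) := by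
        rw [← exp_sum, Finset.sum_neg_distrib, Finset.sum_div, Finset.mul_sum, Finset.sum_mul]
        simp only [mul_assoc]
    _ ≤ _ := by
        rw [exp_le_exp, neg_le_neg_iff, ← hcard]
        have := pEdge_nonneg P k K
        gcongr

lemma pow_le_exp_mul_factorial (w : ℕ) : (w : ℝ) ^ w ≤ exp w * w.factorial := by
  have h := pow_div_factorial_le_exp (w : ℝ) (by positivity) w
  rwa [div_le_iff₀ (by positivity)] at h

lemma choose_le_exp_mul {n w : ℕ} (hw : 1 ≤ w) :
    (n.choose w : ℝ) ≤ exp w * ((n : ℝ) / w) ^ w := by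
  have hw0 : (0 : ℝ) < w := by exact_mod_cast hw
  refine (Nat.choose_le_pow_div w n).trans ?_
  rw [div_pow, ← mul_div_assoc, div_le_div_iff₀ (by positivity) (by positivity)]
  have := mul_le_mul_of_nonneg_left (pow_le_exp_mul_factorial w) (by positivity : (0 : ℝ) ≤ n ^ w)
  linarith

/-- It is unlikely that `s` uniform key rings of size `k` cover fewer than `(1 - δ) s k` keys. -/
lemma sum_card_biUnion_lt_le {P k s : ℕ} (hs : 1 ≤ s) (hk : 1 ≤ k) (hsk : s * k ≤ P) {δ : ℝ}
    (hδ0 : 0 ≤ δ) (hδ1 : δ ≤ 1) :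
    ∑ σ : Fin s → Finset (Fin P), (∏ i, keyWeight P k (σ i)) *
        (if ((Finset.univ.biUnion σ).card : ℝ) < (1 - δ) * (s * k : ℕ) then 1 else 0)
      ≤ exp ((s * k : ℕ) * (1 - δ * log ((P : ℝ) / (s * k : ℕ)))) := by
  have hN : 1 ≤ s * k := Nat.mul_le_mul hs hk
  set N : ℕ := s * k with hNdef
  have hN0 : (0 : ℝ) < N := by exact_mod_cast hN
  have hNP : (N : ℝ) ≤ P := by exact_mod_cast hsk
  have hP0 : (0 : ℝ) < P := hN0.trans_le hNP
  set w : ℕ := ⌊(1 - δ) * (N : ℝ)⌋₊ with hw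
  have hwle : (w : ℝ) ≤ (1 - δ) * N := Nat.floor_le (mul_nonneg (by linarith) hN0.le)
  have hwN : (w : ℝ) ≤ N := by nlinarith
  have hwP : w ≤ P := by
    have : (w : ℝ) ≤ P := hwN.trans hNP
    exact_mod_cast this
  have hkP : k ≤ P := le_trans (by nlinarith) hsk
  have hstep : ∀ σ : Fin s → Finset (Fin P), (∏ i, keyWeight P k (σ i)) *
        (if ((Finset.univ.biUnion σ).card : ℝ) < (1 - δ) * (N : ℕ) then 1 else 0)
      ≤ ∑ W ∈ Finset.powersetCard w Finset.univ,
          ∏ i, (keyWeight P k (σ i) * if σ i ⊆ W then 1 else 0) := by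
    intro σ
    have hnn : ∀ W ∈ Finset.powersetCard w (Finset.univ : Finset (Fin P)),
        0 ≤ ∏ i, (keyWeight P k (σ i) * if σ i ⊆ W then 1 else 0) := fun W _ =>
      Finset.prod_nonneg fun i _ => mul_nonneg (keyWeight_nonneg _ _ _) (by split_ifs <;> norm_num)
    split_ifs with hlt
    · have hcard : (Finset.univ.biUnion σ).card ≤ w := Nat.le_floor hlt.le
      obtain ⟨W, hW1, hW2⟩ := Finset.exists_superset_card_eq hcard (by simpa using hwP)
      refine le_trans (le_of_eq ?_) (Finset.single_le_sum hnn (a := W) (by simp [hW2]))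
      rw [mul_one]
      refine Finset.prod_congr rfl fun i _ => ?_
      rw [if_pos ((Finset.subset_biUnion_of_mem σ (Finset.mem_univ i)).trans hW1), mul_one]
    · rw [mul_zero]; exact Finset.sum_nonneg hnn
  have hmain : ∑ σ : Fin s → Finset (Fin P), (∏ i, keyWeight P k (σ i)) *
        (if ((Finset.univ.biUnion σ).card : ℝ) < (1 - δ) * (N : ℕ) then 1 else 0)
      ≤ P.choose w * ((w : ℝ) / P) ^ N := by
    refine (Finset.sum_le_sum fun σ _ => hstep σ).trans ?_
    rw [Finset.sum_comm]
    calc _ ≤ ∑ W ∈ Finset.powersetCard w (Finset.univ : Finset (Fin P)),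
            (((w : ℝ) / P) ^ k) ^ s := by
          refine Finset.sum_le_sum fun W hW => ?_
          have hWc := (Finset.mem_powersetCard.mp hW).2
          have hprod : ∑ σ : Fin s → Finset (Fin P),
              ∏ i, (keyWeight P k (σ i) * if σ i ⊆ W then 1 else 0)
              = (∑ x, keyWeight P k x * if x ⊆ W then 1 else 0) ^ s := by
            have := Finset.prod_univ_sum (fun _ : Fin s => (Finset.univ : Finset (Finset (Fin P))))
              (fun _ x => keyWeight P k x * if x ⊆ W then (1 : ℝ) else 0)
            rw [Fintype.piFinset_univ] at this
            rw [← this, Finset.prod_const, Finset.card_univ, Fintype.card_fin]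
          rw [hprod, sum_keyWeight_subset, hWc]
          have := choose_ratio_le hwP hkP
          gcongr
      _ = _ := by
          rw [Finset.sum_const, Finset.card_powersetCard, Finset.card_univ, Fintype.card_fin,
            nsmul_eq_mul, ← pow_mul, hNdef, mul_comm k s]
  refine hmain.trans ?_
  rcases Nat.eq_zero_or_pos w with hw0 | hwpos
  · rw [hw0, Nat.cast_zero, zero_div, zero_pow (by omega), mul_zero]; positivity
  have hw0 : (0 : ℝ) < w := by exact_mod_cast hwpos
  have hL : 0 ≤ log ((P : ℝ) / N) := log_nonneg (by rwa [one_le_div hN0])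
  have hLw : log ((P : ℝ) / N) ≤ log ((P : ℝ) / w) := by
    apply log_le_log (by positivity); gcongr
  have e1 : ((P : ℝ) / w) ^ w = exp (w * log ((P : ℝ) / w)) := by
    rw [exp_nat_mul, exp_log (by positivity)]
  have e2 : ((w : ℝ) / P) ^ N = exp (-(N * log ((P : ℝ) / w))) := by
    rw [← mul_neg, ← log_inv, inv_div, exp_nat_mul, exp_log (by positivity)]
  calc _ ≤ exp w * ((P : ℝ) / w) ^ w * ((w : ℝ) / P) ^ N := by
        gcongr; exact choose_le_exp_mul hwpos
    _ = exp (w + w * log ((P : ℝ) / w) - N * log ((P : ℝ) / w)) := by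
        rw [e1, e2, ← exp_add, ← exp_add]; ring_nf
    _ ≤ _ := by
        rw [exp_le_exp]
        have h1 : δ * N ≤ N - w := by linarith
        have h2 : 0 ≤ δ * N := by positivity
        have h3 := mul_le_mul h1 hLw hL (by linarith)
        nlinarith

/-! ### Several blocks of key rings -/

/-- The key rings in a block of `s` rings of size `k` overlap too much. -/
def Overlapping {P s : ℕ} (k : ℕ) (δ : ℝ) (τ : Fin s → Finset (Fin P)) : Prop :=
  ((Finset.univ.biUnion τ).card : ℝ) < (1 - δ) * (s * k : ℕ)

lemma sum_prod_block {β : Type*} [Fintype β] [DecidableEq β] (m s : ℕ) (w : β → ℝ)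
    (f : (Fin s → β) → ℝ) :
    ∑ σ : Fin m × Fin s → β, (∏ x, w (σ x)) * ∏ b, f (fun i => σ (b, i))
      = (∑ τ : Fin s → β, (∏ i, w (τ i)) * f τ) ^ m := by
  have h := Finset.prod_univ_sum (fun _ : Fin m => (Finset.univ : Finset (Fin s → β)))
    (fun _ τ => (∏ i, w (τ i)) * f τ)
  rw [Fintype.piFinset_univ, Finset.prod_const, Finset.card_univ, Fintype.card_fin] at h
  rw [h, ← Equiv.sum_comp (Equiv.curry (Fin m) (Fin s) β)]
  refine Finset.sum_congr rfl fun σ _ => ?_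
  rw [Finset.prod_mul_distrib, Fintype.prod_prod_type]
  rfl

lemma sum_prod_eq_one {β ι : Type*} [Fintype β] [Fintype ι] [DecidableEq ι] {w : β → ℝ}
    (hw : ∑ b, w b = 1) : ∑ σ : ι → β, ∏ i, w (σ i) = 1 := by
  have h := Finset.prod_univ_sum (fun _ : ι => (Finset.univ : Finset β)) (fun _ b => w b)
  rw [Fintype.piFinset_univ] at h
  rw [← h, Finset.prod_const, hw, one_pow]

open scoped Classical in
lemma sum_many_overlapping_le {P k s : ℕ} (m : ℕ) (hkP : k ≤ P) {δ B : ℝ} (hB0 : 0 ≤ B)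
    (hB : ∑ τ : Fin s → Finset (Fin P), (∏ i, keyWeight P k (τ i)) *
      (if Overlapping k δ τ then 1 else 0) ≤ exp (-B)) :
    ∑ σ : Fin m × Fin s → Finset (Fin P), (∏ x, keyWeight P k (σ x)) *
      (if δ * m < (Finset.univ.filter fun b => Overlapping k δ fun i => σ (b, i)).card
        then 1 else 0) ≤ 2 ^ m * exp (-(B * δ * m)) := by
  have hpt : ∀ σ : Fin m × Fin s → Finset (Fin P),
      (if δ * m < (Finset.univ.filter fun b => Overlapping k δ fun i => σ (b, i)).card
        then (1 : ℝ) else 0)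
      ≤ exp (-(B * δ * m)) *
        ∏ b, (1 + exp B * if Overlapping k δ (fun i => σ (b, i)) then 1 else 0) := by
    intro σ
    have hfac : ∀ b : Fin m, (1 : ℝ) + exp B * (if Overlapping k δ (fun i => σ (b, i)) then 1 else 0)
        = if Overlapping k δ (fun i => σ (b, i)) then 1 + exp B else 1 := by
      intro b; split_ifs <;> simp
    simp only [hfac]
    rw [← Finset.prod_filter, Finset.prod_const]
    split_ifs with h
    · calc (1 : ℝ) = exp (-(B * δ * m)) * exp (B * δ * m) := by rw [← exp_add]; simp
        _ ≤ exp (-(B * δ * m)) * exp B ^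
            (Finset.univ.filter fun b => Overlapping k δ fun i => σ (b, i)).card := by
          rw [← exp_nat_mul]
          refine mul_le_mul_of_nonneg_left (exp_le_exp.mpr ?_) (exp_nonneg _)
          nlinarith
        _ ≤ _ := by gcongr; linarith
    · positivity
  calc _ ≤ ∑ σ : Fin m × Fin s → Finset (Fin P), (∏ x, keyWeight P k (σ x)) *
        (exp (-(B * δ * m)) *
        ∏ b, (1 + exp B * if Overlapping k δ (fun i => σ (b, i)) then 1 else 0)) :=
        Finset.sum_le_sum fun σ _ => mul_le_mul_of_nonneg_left (hpt σ)
          (Finset.prod_nonneg fun _ _ => keyWeight_nonneg _ _ _)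
    _ = exp (-(B * δ * m)) * (∑ τ : Fin s → Finset (Fin P), (∏ i, keyWeight P k (τ i)) *
          (1 + exp B * if Overlapping k δ τ then 1 else 0)) ^ m := by
        rw [← sum_prod_block, Finset.mul_sum]
        exact Finset.sum_congr rfl fun σ _ => by ring
    _ ≤ exp (-(B * δ * m)) * 2 ^ m := by
        gcongr
        · refine Finset.sum_nonneg fun τ _ => mul_nonneg
            (Finset.prod_nonneg fun _ _ => keyWeight_nonneg _ _ _) ?_
          split_ifs <;> simp [exp_nonneg, add_nonneg]
        · calc _ = (∑ τ : Fin s → Finset (Fin P), ∏ i, keyWeight P k (τ i)) + exp B *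
                ∑ τ : Fin s → Finset (Fin P), (∏ i, keyWeight P k (τ i)) *
                  (if Overlapping k δ τ then 1 else 0) := by
                rw [Finset.mul_sum, ← Finset.sum_add_distrib]
                exact Finset.sum_congr rfl fun τ _ => by ring
            _ ≤ 1 + exp B * exp (-B) := by
                rw [sum_prod_eq_one (sum_keyWeight hkP)]
                gcongr
            _ = 2 := by rw [← exp_add]; norm_num
    _ = _ := mul_comm _ _

lemma prod_le_avg_pow {ι : Type*} (G : Finset ι) (hG : G.Nonempty) (X : ι → ℝ)
    (hX : ∀ b ∈ G, 0 ≤ X b) : ∏ b ∈ G, X b ≤ (G.card : ℝ)⁻¹ * ∑ b ∈ G, X b ^ G.card := by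
  have hg : (0 : ℝ) < G.card := by exact_mod_cast hG.card_pos
  have h := Real.geom_mean_le_arith_mean_weighted G (fun _ => (G.card : ℝ)⁻¹)
    (fun b => X b ^ G.card) (fun _ _ => by positivity) (by simp [hg.ne'])
    (fun b hb => pow_nonneg (hX b hb) _)
  rw [← Finset.mul_sum] at h
  refine le_trans (le_of_eq (Finset.prod_congr rfl fun b hb => ?_)) h
  rw [Real.pow_rpow_inv_natCast (hX b hb) hG.card_pos.ne']

open scoped Classical in
/-- If few blocks overlap, a fresh key ring has no link to any of them with small probability. -/
lemma sum_keyWeight_prod_noLink_le {P K k m s : ℕ} (hK1 : 1 ≤ K) (hK : K ≤ P) (hk1 : 1 ≤ k)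
    (hk : k ≤ P) (hm : 1 ≤ m) {α δ : ℝ} (hα0 : 0 ≤ α) (hα1 : α ≤ 1) (hδ1 : δ < 1)
    (σ : Fin m × Fin s → Finset (Fin P)) (hσ : ∀ x, (σ x).card = k)
    (hgood : ((Finset.univ.filter fun b => Overlapping k δ fun i => σ (b, i)).card : ℝ) ≤ δ * m) :
    ∑ x, keyWeight P K x * ∏ y, noLink α (σ y) x
      ≤ exp (-((1 - (1 - α) ^ ⌈(1 - δ) * m⌉₊) * ((1 - δ) * s) * pEdge P k K)) := by
  have hm0 : (0 : ℝ) < m := by exact_mod_cast hm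
  have hk0 : (0 : ℝ) < k := by exact_mod_cast hk1
  set G := Finset.univ.filter fun b : Fin m => ¬ Overlapping k δ fun i => σ (b, i) with hGdef
  have hcard : ((Finset.univ.filter fun b => Overlapping k δ fun i => σ (b, i)).card : ℝ)
      + G.card = m := by
    have := Finset.card_filter_add_card_filter_not (s := (Finset.univ : Finset (Fin m)))
      (fun b => Overlapping k δ fun i => σ (b, i))
    rw [Finset.card_univ, Fintype.card_fin] at this
    exact_mod_cast this
  have hGge : (1 - δ) * m ≤ G.card := by linarith
  have hceil : ⌈(1 - δ) * (m : ℝ)⌉₊ ≤ G.card := Nat.ceil_le.mpr hGge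
  have hGpos : 0 < G.card := by
    have : (0 : ℝ) < G.card := lt_of_lt_of_le (mul_pos (by linarith) hm0) hGge
    exact_mod_cast this
  have hG0 : (0 : ℝ) < G.card := by exact_mod_cast hGpos
  have hGne : G.Nonempty := Finset.card_pos.mp hGpos
  set a : ℝ := 1 - (1 - α) ^ G.card with ha
  have hGnot : ∀ b ∈ G, ¬ Overlapping k δ fun i => σ (b, i) := fun b hb =>
    (Finset.mem_filter.mp hb).2
  clear_value G
  generalize ⌈(1 - δ) * (m : ℝ)⌉₊ = g₀ at hceil ⊢
  have hpow0 : 0 ≤ (1 - α) ^ G.card := pow_nonneg (by linarith) _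
  have hpow1 : (1 - α) ^ G.card ≤ 1 := pow_le_one₀ (by linarith) (by linarith)
  have hpowle : (1 - α) ^ G.card ≤ (1 - α) ^ g₀ :=
    pow_le_pow_of_le_one (by linarith) (by linarith) hceil
  have hX : ∀ x, ∏ y, noLink α (σ y) x
      ≤ (G.card : ℝ)⁻¹ * ∑ b ∈ G, ∏ i, noLink a (σ (b, i)) x := by
    intro x
    calc _ = ∏ b, ∏ i, noLink α (σ (b, i)) x := by rw [Fintype.prod_prod_type]
      _ ≤ ∏ b ∈ G, ∏ i, noLink α (σ (b, i)) x := by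
          rw [← Finset.prod_mul_prod_compl G]
          exact mul_le_of_le_one_right
            (Finset.prod_nonneg fun b _ => Finset.prod_nonneg fun i _ => noLink_nonneg hα1 _ _)
            (Finset.prod_le_one
              (fun b _ => Finset.prod_nonneg fun i _ => noLink_nonneg hα1 _ _)
              fun b _ => Finset.prod_le_one (fun i _ => noLink_nonneg hα1 _ _)
                fun i _ => noLink_le_one hα0 _ _)
      _ ≤ (G.card : ℝ)⁻¹ * ∑ b ∈ G, (∏ i, noLink α (σ (b, i)) x) ^ G.card :=
          prod_le_avg_pow G hGne _ fun b _ => Finset.prod_nonneg fun i _ => noLink_nonneg hα1 _ _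
      _ = _ := by
          congr 1
          refine Finset.sum_congr rfl fun b _ => ?_
          rw [← Finset.prod_pow]
          exact Finset.prod_congr rfl fun i _ => noLink_pow _ _ _ _
  calc _ ≤ ∑ x, keyWeight P K x * ((G.card : ℝ)⁻¹ * ∑ b ∈ G, ∏ i, noLink a (σ (b, i)) x) :=
        Finset.sum_le_sum fun x _ => mul_le_mul_of_nonneg_left (hX x) (keyWeight_nonneg _ _ _)
    _ = (G.card : ℝ)⁻¹ * ∑ b ∈ G, ∑ x, keyWeight P K x * ∏ i, noLink a (σ (b, i)) x := by
        rw [Finset.sum_comm, Finset.mul_sum]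
        refine Finset.sum_congr rfl fun x _ => ?_
        rw [← Finset.mul_sum]; ring
    _ ≤ (G.card : ℝ)⁻¹ * ∑ _b ∈ G,
          exp (-((1 - (1 - α) ^ g₀) * ((1 - δ) * s) * pEdge P k K)) := by
        gcongr with b hb
        have hb' := hGnot b hb
        rw [Overlapping, not_lt] at hb'
        refine (sum_keyWeight_noLink_le hK1 hK hk1 hk (by linarith) (by linarith)
          (fun i => σ (b, i)) (fun i => (hσ _).le) hb').trans ?_
        rw [exp_le_exp, neg_le_neg_iff]
        have hp := pEdge_nonneg P k K
        have hU : (1 - δ) * ((s * k : ℕ) : ℝ) / k = (1 - δ) * s := by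
          push_cast; field_simp
        rw [hU]
        have h0 : 0 ≤ (1 - δ) * (s : ℝ) := mul_nonneg (by linarith) (by positivity)
        have ha' : 1 - (1 - α) ^ g₀ ≤ a := by linarith
        gcongr
    _ = _ := by
        rw [Finset.sum_const, nsmul_eq_mul, ← mul_assoc, inv_mul_cancel₀ hG0.ne', one_mul]

/-- The law of the key ring of a vertex. -/
def ringWeight {r : ℕ} (μ : Fin r → ℝ) (K : Fin r → ℕ) (P : ℕ) (x : Finset (Fin P)) : ℝ :=
  ∑ j, μ j * keyWeight P (K j) x

section RingWeight

variable {r : ℕ} {μ : Fin r → ℝ} {K : Fin r → ℕ} {P : ℕ}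

lemma ringWeight_nonneg (hμ : ∀ i, 0 ≤ μ i) (x : Finset (Fin P)) : 0 ≤ ringWeight μ K P x :=
  Finset.sum_nonneg fun j _ => mul_nonneg (hμ j) (keyWeight_nonneg _ _ _)

lemma sum_ringWeight_mul (f : Finset (Fin P) → ℝ) :
    ∑ x, ringWeight μ K P x * f x = ∑ j, μ j * ∑ x, keyWeight P (K j) x * f x := by
  simp only [ringWeight, Finset.sum_mul, Finset.mul_sum]
  rw [Finset.sum_comm]
  exact Finset.sum_congr rfl fun _ _ => Finset.sum_congr rfl fun _ _ => by ring

lemma sum_ringWeight (hμ1 : ∑ i, μ i = 1) (hK : ∀ j, K j ≤ P) : ∑ x, ringWeight μ K P x = 1 := by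
  have := sum_ringWeight_mul (μ := μ) (K := K) (P := P) (fun _ => 1)
  simp only [mul_one] at this
  rw [this]
  simp only [sum_keyWeight (hK _), mul_one, hμ1]

/-- The probability that a fresh vertex has no link to vertices with the given key rings. -/
def missProb {ι : Type*} [Fintype ι] (μ : Fin r → ℝ) (K : Fin r → ℕ) (α : ℝ)
    (σ : ι → Finset (Fin P)) : ℝ :=
  ∑ x, ringWeight μ K P x * ∏ y, noLink α (σ y) x

variable {α : ℝ}

lemma missProb_nonneg {ι : Type*} [Fintype ι] (hμ : ∀ i, 0 ≤ μ i) (hα1 : α ≤ 1)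
    (σ : ι → Finset (Fin P)) : 0 ≤ missProb μ K α σ :=
  Finset.sum_nonneg fun x _ => mul_nonneg (ringWeight_nonneg hμ x)
    (Finset.prod_nonneg fun _ _ => noLink_nonneg hα1 _ _)

lemma missProb_le_one {ι : Type*} [Fintype ι] (hμ : ∀ i, 0 ≤ μ i) (hμ1 : ∑ i, μ i = 1)
    (hK : ∀ j, K j ≤ P) (hα0 : 0 ≤ α) (hα1 : α ≤ 1)
    (σ : ι → Finset (Fin P)) : missProb μ K α σ ≤ 1 := by
  rw [← sum_ringWeight (P := P) hμ1 hK]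
  refine Finset.sum_le_sum fun x _ => mul_le_of_le_one_right (ringWeight_nonneg hμ x) ?_
  exact Finset.prod_le_one (fun i _ => noLink_nonneg hα1 _ _) fun i _ => noLink_le_one hα0 _ _

lemma missProb_antitone {ι : Type*} [Fintype ι] (hμ : ∀ i, 0 ≤ μ i) (hα0 : 0 ≤ α) (hα1 : α ≤ 1) :
    Antitone (missProb μ K α : (ι → Finset (Fin P)) → ℝ) := by
  intro σ τ h
  refine Finset.sum_le_sum fun x _ => mul_le_mul_of_nonneg_left ?_ (ringWeight_nonneg hμ x)
  exact Finset.prod_le_prod (fun i _ => noLink_nonneg hα1 _ _) fun i _ => noLink_anti hα0 (h i) x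

/-- The bound on the probability that a fresh vertex has no link to `m` blocks of `s` vertices. -/
def missBound (μ : Fin r → ℝ) (K : Fin r → ℕ) (P : ℕ) (α δ : ℝ) (k m s : ℕ) : ℝ :=
  ∑ j, μ j * exp (-((1 - (1 - α) ^ ⌈(1 - δ) * m⌉₊) * ((1 - δ) * s) * pEdge P k (K j)))

lemma sum_missProb_pow_le (hμ : ∀ i, 0 ≤ μ i) (hμ1 : ∑ i, μ i = 1)
    (hK1 : ∀ j, 1 ≤ K j) (hK : ∀ j, K j ≤ P) {k m s : ℕ} (hk1 : 1 ≤ k) (hkK : ∀ j, k ≤ K j)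
    (hk : k ≤ P) (hm : 1 ≤ m) {δ B : ℝ} (hα0 : 0 ≤ α) (hα1 : α ≤ 1) (hδ1 : δ < 1) (hB0 : 0 ≤ B)
    (hB : exp ((s * k : ℕ) * (1 - δ * log ((P : ℝ) / (s * k : ℕ)))) ≤ exp (-B)) (hδ0 : 0 ≤ δ)
    (hs : 1 ≤ s) (hsk : s * k ≤ P) (t : ℕ) :
    ∑ σ : Fin m × Fin s → Finset (Fin P), (∏ x, ringWeight μ K P (σ x)) * missProb μ K α σ ^ t
      ≤ 2 ^ m * exp (-(B * δ * m)) + missBound μ K P α δ k m s ^ t := by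
  classical
  have hmiss0 : ∀ σ : Fin m × Fin s → Finset (Fin P), 0 ≤ missProb μ K α σ :=
    missProb_nonneg hμ hα1
  have hover : ∑ τ : Fin s → Finset (Fin P), (∏ i, keyWeight P k (τ i)) *
      (if Overlapping k δ τ then 1 else 0) ≤ exp (-B) := by
    refine le_trans (le_of_eq (Finset.sum_congr rfl fun τ _ => ?_))
      ((sum_card_biUnion_lt_le hs hk1 hsk hδ0 hδ1.le).trans hB)
    congr 1
  have hbad := sum_many_overlapping_le m hk hB0 hover
  calc _ ≤ ∑ σ : Fin m × Fin s → Finset (Fin P), (∏ x, keyWeight P k (σ x)) *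
        missProb μ K α σ ^ t := by
        refine sum_prod_mul_le_of_antitone (ringWeight_nonneg hμ) (keyWeight_nonneg P k) ?_ _
          (fun σ => missProb μ K α σ ^ t) ?_
        · intro f hf
          rw [sum_ringWeight_mul]
          calc _ ≤ ∑ j, μ j * ∑ x, keyWeight P k x * f x :=
                Finset.sum_le_sum fun j _ => mul_le_mul_of_nonneg_left
                  (sum_keyWeight_antitone (hkK j) (hK j) hf) (hμ j)
            _ = _ := by rw [← Finset.sum_mul, hμ1, one_mul]
        · intro σ τ h
          exact pow_le_pow_left₀ (hmiss0 _) (missProb_antitone hμ hα0 hα1 h) t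
    _ ≤ ∑ σ : Fin m × Fin s → Finset (Fin P), ((∏ x, keyWeight P k (σ x)) *
          (if δ * m < (Finset.univ.filter fun b => Overlapping k δ fun i => σ (b, i)).card
          then 1 else 0) + (∏ x, keyWeight P k (σ x)) * missBound μ K P α δ k m s ^ t) := by
        refine Finset.sum_le_sum fun σ _ => ?_
        have hMB : 0 ≤ missBound μ K P α δ k m s :=
          Finset.sum_nonneg fun j _ => mul_nonneg (hμ j) (exp_nonneg _)
        rw [← mul_add]
        by_cases hσ : ∀ x, (σ x).card = k
        · refine mul_le_mul_of_nonneg_left ?_ (Finset.prod_nonneg fun _ _ => keyWeight_nonneg _ _ _)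
          split_ifs with h
          · have := pow_le_one₀ (n := t) (hmiss0 σ) (missProb_le_one hμ hμ1 hK hα0 hα1 σ)
            have := pow_nonneg hMB t
            linarith
          · rw [zero_add]
            refine pow_le_pow_left₀ (hmiss0 _) ?_ t
            rw [missProb, sum_ringWeight_mul]
            exact Finset.sum_le_sum fun j _ => mul_le_mul_of_nonneg_left
              (sum_keyWeight_prod_noLink_le (hK1 j) (hK j) hk1 hk hm hα0 hα1 hδ1 σ hσ
                (not_lt.mp h)) (hμ j)
        · push Not at hσ
          obtain ⟨x, hx⟩ := hσ
          have : ∏ x, keyWeight P k (σ x) = 0 :=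
            Finset.prod_eq_zero (Finset.mem_univ x) (by simp [keyWeight, hx])
          rw [this, zero_mul, zero_mul]
    _ ≤ _ := by
        rw [Finset.sum_add_distrib, ← Finset.sum_mul, sum_prod_eq_one (sum_keyWeight hk), one_mul]
        gcongr

end RingWeight

/-! ### Cuts -/

/-- There is no edge between `S` and its complement. -/
def IsCut {n r P : ℕ} (S : Finset (Fin n)) (cfg : Config n r P) : Prop :=
  ∀ x ∈ S, ∀ y ∉ S, ¬ adj cfg x y

lemma adj_symm {n r P : ℕ} {cfg : Config n r P} {x y : Fin n} (h : adj cfg x y) :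
    adj cfg y x := by
  refine ⟨h.1.symm, by rw [Finset.inter_comm]; exact h.2.1, ?_⟩
  have := h.2.2
  unfold coin at this ⊢
  rcases lt_trichotomy x y with hxy | hxy | hxy
  · rw [dif_pos hxy] at this
    rw [dif_neg hxy.asymm, dif_pos hxy, this]
  · exact absurd hxy h.1
  · rw [dif_neg hxy.asymm, dif_pos hxy] at this
    rw [dif_pos hxy, this]

lemma exists_isCut_of_not_conn {n r P : ℕ} {cfg : Config n r P} (h : ¬ conn cfg) :
    ∃ S : Finset (Fin n), S.Nonempty ∧ 2 * S.card ≤ n ∧ IsCut S cfg := by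
  classical
  unfold conn at h
  push Not at h
  obtain ⟨x, y, hxy⟩ := h
  set C : Finset (Fin n) := Finset.univ.filter fun z => Relation.ReflTransGen (adj cfg) x z with hC
  have hmem : ∀ z, z ∈ C ↔ Relation.ReflTransGen (adj cfg) x z := by simp [hC]
  have hcut : ∀ u ∈ C, ∀ v ∉ C, ¬ adj cfg u v := fun u hu v hv huv =>
    hv ((hmem v).mpr (((hmem u).mp hu).tail huv))
  have hcard : C.card + Cᶜ.card = n := by
    rw [Finset.card_add_card_compl, Fintype.card_fin]
  rcases le_total C.card Cᶜ.card with hle | hle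
  · exact ⟨C, ⟨x, (hmem x).mpr .refl⟩, by omega, hcut⟩
  · refine ⟨Cᶜ, ⟨y, ?_⟩, by omega, ?_⟩
    · rw [Finset.mem_compl, hmem]; exact hxy
    · intro u hu v hv huv
      rw [Finset.mem_compl] at hu
      rw [Finset.mem_compl, not_not] at hv
      exact hcut v hv u hu (adj_symm huv)

lemma sum_prod_marginal {V ι β : Type*} [Fintype V] [DecidableEq V] [Fintype ι] [DecidableEq ι]
    [Fintype β] [DecidableEq β] (w : β → ℝ) (e : ι → V) (he : Function.Injective e)
    (T : Finset V) (hT : ∀ i, e i ∉ T) (ψ : (ι → β) → β → ℝ) (hw : ∑ b, w b = 1) :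
    ∑ σ : V → β, (∏ x, w (σ x)) * ∏ y ∈ T, ψ (σ ∘ e) (σ y)
      = ∑ τ : ι → β, (∏ i, w (τ i)) * (∑ b, w b * ψ τ b) ^ T.card := by
  classical
  let E : ι ⊕ {x // ¬ x ∈ Set.range e} ≃ V :=
    (Equiv.sumCongr (Equiv.ofInjective e he) (Equiv.refl _)).trans
      (Equiv.sumCompl (fun x => x ∈ Set.range e))
  have hEl : ∀ i, E (Sum.inl i) = e i := fun i => rfl
  have hEr : ∀ z, E (Sum.inr z) = z.1 := fun z => rfl
  have hEe : ∀ i, E.symm (e i) = Sum.inl i := fun i => by rw [← hEl, Equiv.symm_apply_apply]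
  have hprodT : ∀ f : V → ℝ, ∏ y ∈ T, f y
      = ∏ z : {x // ¬ x ∈ Set.range e}, if z.1 ∈ T then f z.1 else 1 := by
    intro f
    calc _ = ∏ y, if y ∈ T then f y else 1 := by
          rw [← Finset.prod_filter]; simp
      _ = ∏ z, if E z ∈ T then f (E z) else 1 := (Equiv.prod_comp E _).symm
      _ = _ := by
          rw [Fintype.prod_sum_type]
          simp only [hEl, hEr, hT, if_false, Finset.prod_const_one, one_mul]
  rw [← Equiv.sum_comp ((Equiv.sumArrowEquivProdArrow ι _ β).symm.trans
    (E.arrowCongr (Equiv.refl β))), Fintype.sum_prod_type]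
  refine Finset.sum_congr rfl fun τ _ => ?_
  have hcomp : ∀ ρ : {x // ¬ x ∈ Set.range e} → β,
      ((Equiv.sumArrowEquivProdArrow ι _ β).symm.trans (E.arrowCongr (Equiv.refl β))) (τ, ρ)
        = Sum.elim τ ρ ∘ E.symm := fun ρ => rfl
  have hterm : ∀ ρ : {x // ¬ x ∈ Set.range e} → β,
      (∏ x, w ((Sum.elim τ ρ ∘ E.symm) x)) *
        ∏ y ∈ T, ψ ((Sum.elim τ ρ ∘ E.symm) ∘ e) ((Sum.elim τ ρ ∘ E.symm) y)
      = (∏ i, w (τ i)) * ∏ z, (w (ρ z) * if z.1 ∈ T then ψ τ (ρ z) else 1) := by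
    intro ρ
    have h1 : (Sum.elim τ ρ ∘ E.symm) ∘ e = τ := by
      funext i; simp [hEe]
    have h2 : ∀ z : {x // ¬ x ∈ Set.range e}, (Sum.elim τ ρ ∘ E.symm) z.1 = ρ z := by
      intro z; rw [← hEr]; simp
    rw [h1, hprodT, Finset.prod_mul_distrib, ← mul_assoc]
    congr 1
    · rw [← Equiv.prod_comp E, Fintype.prod_sum_type]
      simp
    · simp only [h2]
  simp only [hcomp, hterm]
  rw [← Finset.mul_sum]
  congr 1
  have h := Finset.prod_univ_sum
    (fun _ : {x // ¬ x ∈ Set.range e} => (Finset.univ : Finset β))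
    (fun z b => w b * if z.1 ∈ T then ψ τ b else 1)
  rw [Fintype.piFinset_univ] at h
  rw [← h, ← Finset.prod_const, hprodT]
  refine Finset.prod_congr rfl fun z _ => ?_
  split_ifs
  · rfl
  · simp [hw]

lemma prod_coin_sum {n : ℕ} (α : ℝ) (D : Finset (Pairs n)) :
    ∑ b : Pairs n → Bool, (∏ p, if b p then α else 1 - α) *
        (if ∀ p ∈ D, b p = false then 1 else 0) = (1 - α) ^ D.card := by
  have h := Finset.prod_univ_sum (fun _ : Pairs n => (Finset.univ : Finset Bool))
    (fun p c => (if c then α else 1 - α) * if p ∈ D ∧ c = true then 0 else 1)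
  rw [Fintype.piFinset_univ] at h
  have hl : ∏ p : Pairs n, ∑ c : Bool,
      ((if c then α else 1 - α) * if p ∈ D ∧ c = true then 0 else 1) = (1 - α) ^ D.card := by
    rw [← Finset.prod_const, ← Finset.prod_subset (Finset.subset_univ D)]
    · refine Finset.prod_congr rfl fun p hp => ?_
      simp [hp]
    · intro p _ hp
      simp [hp]
  rw [← hl, h]
  refine Finset.sum_congr rfl fun b _ => ?_
  rw [Finset.prod_mul_distrib]
  congr 1
  split_ifs with hb
  · refine (Finset.prod_eq_one fun p _ => ?_).symm
    rw [if_neg]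
    rintro ⟨hp, hc⟩
    simp [hb p hp] at hc
  · push Not at hb
    obtain ⟨p, hp, hc⟩ := hb
    refine (Finset.prod_eq_zero (Finset.mem_univ p) ?_).symm
    rw [if_pos ⟨hp, by simpa using hc⟩]

section Graph

variable {n r P : ℕ} {μ : Fin r → ℝ} {K : Fin r → ℕ} {α : ℝ}

lemma weight_nonneg (hμ : ∀ i, 0 ≤ μ i) (hα0 : 0 ≤ α) (hα1 : α ≤ 1) (cfg : Config n r P) :
    0 ≤ weight μ K α cfg := by
  refine mul_nonneg (Finset.prod_nonneg fun x _ => mul_nonneg (hμ _) (keyWeight_nonneg _ _ _))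
    (Finset.prod_nonneg fun p _ => ?_)
  split_ifs <;> linarith

lemma sum_weight_mul (f : (Fin n → Finset (Fin P)) → (Pairs n → Bool) → ℝ) :
    ∑ cfg : Config n r P, weight μ K α cfg * f cfg.2.1 cfg.2.2
      = ∑ σ : Fin n → Finset (Fin P), (∏ x, ringWeight μ K P (σ x)) *
          ∑ b : Pairs n → Bool, (∏ p, if b p then α else 1 - α) * f σ b := by
  have hring : ∀ σ : Fin n → Finset (Fin P), ∏ x, ringWeight μ K P (σ x)
      = ∑ t : Fin n → Fin r, ∏ x, μ (t x) * keyWeight P (K (t x)) (σ x) := by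
    intro σ
    have h := Finset.prod_univ_sum (fun _ : Fin n => (Finset.univ : Finset (Fin r)))
      (fun x j => μ j * keyWeight P (K j) (σ x))
    rw [Fintype.piFinset_univ] at h
    exact h
  simp only [Fintype.sum_prod_type, hring, Finset.sum_mul]
  rw [Finset.sum_comm]
  refine Finset.sum_congr rfl fun σ _ => Finset.sum_congr rfl fun t _ => ?_
  rw [Finset.mul_sum]
  refine Finset.sum_congr rfl fun b _ => ?_
  simp only [weight]
  ring

lemma sum_weight (hμ1 : ∑ i, μ i = 1) (hK : ∀ j, K j ≤ P) :
    ∑ cfg : Config n r P, weight μ K α cfg = 1 := by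
  have h := sum_weight_mul (n := n) (P := P) (μ := μ) (K := K) (α := α) (fun _ _ => 1)
  have h' := prod_coin_sum (n := n) α ∅
  simp only [mul_one] at h
  simp only [Finset.notMem_empty, false_imp_iff, implies_true, if_true, mul_one,
    Finset.card_empty, pow_zero] at h'
  rw [h, h']
  simp only [mul_one]
  exact sum_prod_eq_one (sum_ringWeight hμ1 hK)

lemma one_sub_Pr_not (hμ1 : ∑ i, μ i = 1) (hK : ∀ j, K j ≤ P) (E : Config n r P → Prop) :
    Pr μ K α E = 1 - Pr μ K α fun cfg => ¬ E cfg := by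
  rw [← sum_weight (n := n) (α := α) hμ1 hK, Pr, Pr, ← Finset.sum_sub_distrib]
  refine Finset.sum_congr rfl fun cfg _ => ?_
  by_cases h : E cfg <;> simp [h]

lemma Pr_nonneg (hμ : ∀ i, 0 ≤ μ i) (hα0 : 0 ≤ α) (hα1 : α ≤ 1) (E : Config n r P → Prop) :
    0 ≤ Pr μ K α E :=
  Finset.sum_nonneg fun cfg _ => by
    split_ifs
    · exact weight_nonneg hμ hα0 hα1 cfg
    · exact le_refl _

/-- A cut at `S` is at most as likely as the event that a sample of `S` has no link to `Sᶜ`. -/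
lemma Pr_isCut_le (hμ : ∀ i, 0 ≤ μ i) (hμ1 : ∑ i, μ i = 1) (hK : ∀ j, K j ≤ P) (hα0 : 0 ≤ α)
    (hα1 : α ≤ 1) {ι : Type*} [Fintype ι] [DecidableEq ι] (S : Finset (Fin n)) (e : ι → Fin n)
    (he : Function.Injective e) (heS : ∀ i, e i ∈ S) :
    Pr μ K α (IsCut S : Config n r P → Prop)
      ≤ ∑ τ : ι → Finset (Fin P), (∏ i, ringWeight μ K P (τ i)) *
          missProb μ K α τ ^ (n - S.card) := by
  classical
  let D : (Fin n → Finset (Fin P)) → Finset (Pairs n) := fun σ => Finset.univ.filter fun p =>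
    ∃ i, ∃ y ∉ S, (σ (e i) ∩ σ y).Nonempty ∧ (p.1 = (e i, y) ∨ p.1 = (y, e i))
  let N : (Fin n → Finset (Fin P)) → Finset (ι × Fin n) := fun σ =>
    (Finset.univ ×ˢ Sᶜ).filter fun q => (σ (e q.1) ∩ σ q.2).Nonempty
  have hcut : ∀ cfg : Config n r P, IsCut S cfg → ∀ p ∈ D cfg.2.1, cfg.2.2 p = false := by
    intro cfg h p hp
    obtain ⟨i, y, hy, hne, hp'⟩ := (Finset.mem_filter.mp hp).2
    have hiy : e i ≠ y := fun h => hy (h ▸ heS i)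
    have hnadj := h (e i) (heS i) y hy
    have hcoin : coin cfg.2.2 (e i) y = cfg.2.2 p := by
      obtain ⟨⟨u, v⟩, huv⟩ := p
      simp only at huv hp'
      unfold coin
      rcases hp' with hp' | hp' <;> obtain ⟨rfl, rfl⟩ := Prod.mk.inj hp'
      · rw [dif_pos huv]
      · rw [dif_neg huv.asymm, dif_pos huv]
    by_contra hb
    exact hnadj ⟨hiy, hne, by rw [hcoin]; simpa using hb⟩
  have hND : ∀ σ, (N σ).card ≤ (D σ).card := by
    intro σ
    refine le_trans ?_ (Finset.card_image_le (f := Subtype.val) (s := D σ))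
    refine Finset.card_le_card_of_injOn (fun q => (min (e q.1) q.2, max (e q.1) q.2)) ?_ ?_
    · rintro ⟨i, y⟩ hq
      simp only [N, Finset.coe_filter, Set.mem_ofPred_eq, Finset.mem_product, Finset.mem_univ,
        Finset.mem_compl, true_and] at hq
      have hiy : e i ≠ y := fun h => hq.1 (h ▸ heS i)
      simp only [Finset.coe_image, Set.mem_image, D, Finset.coe_filter, Finset.mem_univ, true_and,
        Set.mem_ofPred_eq]
      rcases lt_or_gt_of_ne hiy with h | h
      · exact ⟨⟨(e i, y), h⟩, ⟨i, y, hq.1, hq.2, Or.inl rfl⟩, by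
          simp [min_eq_left h.le, max_eq_right h.le]⟩
      · exact ⟨⟨(y, e i), h⟩, ⟨i, y, hq.1, hq.2, Or.inr rfl⟩, by
          simp [min_eq_right h.le, max_eq_left h.le]⟩
    · rintro ⟨i, y⟩ hq ⟨i', y'⟩ hq' h
      simp only [N, Finset.coe_filter, Set.mem_ofPred_eq, Finset.mem_product, Finset.mem_univ,
        Finset.mem_compl, true_and] at hq hq'
      have h1 : e i ≠ y' := fun h => hq'.1 (h ▸ heS i)
      have h2 : e i' ≠ y := fun h => hq.1 (h ▸ heS i')
      simp only [Prod.mk.injEq] at h ⊢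
      have : e i = e i' ∧ y = y' := by
        rcases le_total (e i) y with h3 | h3 <;> rcases le_total (e i') y' with h4 | h4 <;>
          simp only [h3, h4, min_eq_left, min_eq_right, max_eq_left, max_eq_right] at h
        · exact h
        · exact absurd h.1 h1
        · exact absurd h.2 h1
        · exact h.symm
      exact ⟨he this.1, this.2⟩
  have hprod : ∀ σ : Fin n → Finset (Fin P), (1 - α) ^ (N σ).card
      = ∏ y ∈ Sᶜ, ∏ i, noLink α ((σ ∘ e) i) (σ y) := by
    intro σ
    rw [← Finset.prod_const, Finset.prod_filter, Finset.prod_product_right]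
    rfl
  calc _ = ∑ cfg : Config n r P, weight μ K α cfg * (if IsCut S cfg then 1 else 0) := by
        unfold Pr
        exact Finset.sum_congr rfl fun cfg _ => by split_ifs <;> simp
    _ ≤ ∑ cfg : Config n r P, weight μ K α cfg *
          (if ∀ p ∈ D cfg.2.1, cfg.2.2 p = false then 1 else 0) := by
        refine Finset.sum_le_sum fun cfg _ => mul_le_mul_of_nonneg_left ?_
          (weight_nonneg hμ hα0 hα1 cfg)
        by_cases h : IsCut S cfg
        · rw [if_pos h, if_pos (hcut cfg h)]
        · rw [if_neg h]; split_ifs <;> norm_num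
    _ = ∑ σ : Fin n → Finset (Fin P), (∏ x, ringWeight μ K P (σ x)) * (1 - α) ^ (D σ).card := by
        rw [sum_weight_mul (fun σ b => if ∀ p ∈ D σ, b p = false then (1 : ℝ) else 0)]
        refine Finset.sum_congr rfl fun σ _ => ?_
        rw [prod_coin_sum]
    _ ≤ ∑ σ : Fin n → Finset (Fin P), (∏ x, ringWeight μ K P (σ x)) *
          ∏ y ∈ Sᶜ, ∏ i, noLink α ((σ ∘ e) i) (σ y) := by
        refine Finset.sum_le_sum fun σ _ => mul_le_mul_of_nonneg_left ?_
          (Finset.prod_nonneg fun x _ => ringWeight_nonneg hμ _)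
        rw [← hprod]
        exact pow_le_pow_of_le_one (by linarith) (by linarith) (hND σ)
    _ = _ := by
        rw [sum_prod_marginal (ringWeight μ K P) e he Sᶜ (fun i => by simp [heS i])
          (fun τ x => ∏ i, noLink α (τ i) x) (sum_ringWeight hμ1 hK),
          Finset.card_compl, Fintype.card_fin]
        rfl

lemma Pr_not_conn_le (hμ : ∀ i, 0 ≤ μ i) (hμ1 : ∑ i, μ i = 1) (hK : ∀ j, K j ≤ P) (hα0 : 0 ≤ α)
    (hα1 : α ≤ 1) (bound : ℕ → ℝ) (hbound : ∀ l, 1 ≤ l → 2 * l ≤ n → ∃ m s, m * s ≤ l ∧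
      ∑ σ : Fin m × Fin s → Finset (Fin P), (∏ i, ringWeight μ K P (σ i)) *
        missProb μ K α σ ^ (n - l) ≤ bound l) :
    Pr μ K α (fun cfg : Config n r P => ¬ conn cfg)
      ≤ ∑ l ∈ Finset.Icc 1 (n / 2), (n.choose l : ℝ) * bound l := by
  classical
  have hS : ∀ S : Finset (Fin n), 1 ≤ S.card → 2 * S.card ≤ n →
      Pr μ K α (IsCut S : Config n r P → Prop) ≤ bound S.card := by
    intro S h1 h2
    obtain ⟨m, s, hms, hb⟩ := hbound S.card h1 h2
    obtain ⟨e⟩ : Nonempty (Fin m × Fin s ↪ S) :=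
      Function.Embedding.nonempty_of_card_le (by simpa using hms)
    exact (Pr_isCut_le hμ hμ1 hK hα0 hα1 S (fun i => (e i).1)
      (fun i j h => e.injective (Subtype.ext h)) fun i => (e i).2).trans hb
  calc _ ≤ ∑ cfg : Config n r P, ∑ l ∈ Finset.Icc 1 (n / 2),
          ∑ S ∈ Finset.powersetCard l (Finset.univ : Finset (Fin n)),
            (if IsCut S cfg then weight μ K α cfg else 0) := by
        refine Finset.sum_le_sum fun cfg _ => ?_
        have hw := weight_nonneg (K := K) hμ hα0 hα1 cfg
        have hnn : ∀ S : Finset (Fin n), 0 ≤ if IsCut S cfg then weight μ K α cfg else 0 := by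
          intro S; split_ifs <;> simp [hw]
        split_ifs with h
        · obtain ⟨S, hS1, hS2, hS3⟩ := exists_isCut_of_not_conn h
          have hl : S.card ∈ Finset.Icc 1 (n / 2) := by
            rw [Finset.mem_Icc]; exact ⟨hS1.card_pos, by omega⟩
          refine le_trans ?_ (Finset.single_le_sum
            (fun l _ => Finset.sum_nonneg fun S _ => hnn S) hl)
          refine le_trans ?_ (Finset.single_le_sum (fun S _ => hnn S) (a := S) (by simp))
          rw [if_pos hS3]
        · exact Finset.sum_nonneg fun l _ => Finset.sum_nonneg fun S _ => hnn S
    _ = ∑ l ∈ Finset.Icc 1 (n / 2), ∑ S ∈ Finset.powersetCard l (Finset.univ : Finset (Fin n)),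
          Pr μ K α (IsCut S : Config n r P → Prop) := by
        rw [Finset.sum_comm]
        refine Finset.sum_congr rfl fun l _ => ?_
        rw [Finset.sum_comm]
        refine Finset.sum_congr rfl fun S _ => ?_
        unfold Pr
        exact Finset.sum_congr rfl fun cfg _ => if_congr Iff.rfl rfl rfl
    _ ≤ ∑ l ∈ Finset.Icc 1 (n / 2),
          ∑ _S ∈ Finset.powersetCard l (Finset.univ : Finset (Fin n)), bound l := by
        refine Finset.sum_le_sum fun l hl => Finset.sum_le_sum fun S hSl => ?_
        rw [Finset.mem_Icc] at hl
        obtain rfl := (Finset.mem_powersetCard.mp hSl).2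
        exact hS S hl.1 (by omega)
    _ = _ := by simp

end Graph

/-! ### Estimates of the individual terms -/

/-- Split `l` vertices into `m` blocks of a common size `s ≤ R`, losing few vertices. -/
lemma exists_block_sizes {δ R : ℝ} (hδ0 : 0 < δ) (hδ1 : δ ≤ 1 / 2) (hR : 200 / δ ≤ R) {l : ℕ}
    (hl : 1 ≤ l) :
    ∃ m s : ℕ, 1 ≤ m ∧ 1 ≤ s ∧ m * s ≤ l ∧ (s : ℝ) ≤ R ∧ (1 - δ) * l ≤ (m : ℝ) * s ∧
      (m = 1 ∨ R / 4 ≤ s) := by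
  have hR1 : 200 ≤ R := by
    refine le_trans ?_ hR
    rw [le_div_iff₀ hδ0]; linarith
  have hRδ : 200 ≤ R * δ := by rwa [div_le_iff₀ hδ0] at hR
  have hl1 : (1 : ℝ) ≤ l := by exact_mod_cast hl
  set m := ⌈(l : ℝ) / R⌉₊ with hm
  have hm1 : 1 ≤ m := Nat.one_le_ceil_iff.2 (by positivity)
  have hml : m ≤ l := by
    refine Nat.ceil_le.2 (div_le_self (by positivity) (by linarith))
  have hmlt : (m : ℝ) < l / R + 1 := Nat.ceil_lt_add_one (by positivity)
  have hlem : (l : ℝ) ≤ m * R := by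
    have := Nat.le_ceil ((l : ℝ) / R)
    rwa [div_le_iff₀ (by linarith)] at this
  have hs1 : 1 ≤ l / m := (Nat.one_le_div_iff hm1).2 hml
  have hsl : m * (l / m) ≤ l := Nat.mul_div_le l m
  have hsR : ((l / m : ℕ) : ℝ) ≤ R := by
    have hm0 : (0 : ℝ) < m := by exact_mod_cast hm1
    have : (m : ℝ) * (l / m : ℕ) ≤ m * R := le_trans (by exact_mod_cast hsl) hlem
    exact le_of_mul_le_mul_left this hm0
  refine ⟨m, l / m, hm1, hs1, hsl, hsR, ?_⟩
  rcases Nat.eq_or_lt_of_le hm1 with h1 | h2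
  · rw [← h1, Nat.div_one]
    refine ⟨?_, Or.inl rfl⟩
    push_cast
    nlinarith
  · have hlt : (l : ℝ) < m * ((l / m : ℕ) + 1) := by
      exact_mod_cast Nat.lt_mul_div_succ l hm1
    have hm2 : (2 : ℝ) ≤ m := by exact_mod_cast h2
    have hmR : ((m : ℝ) - 1) * R < l := by
      have : (m : ℝ) - 1 < l / R := by linarith
      rwa [lt_div_iff₀ (by linarith)] at this
    have hmδ : (m : ℝ) ≤ δ * l := by nlinarith
    refine ⟨by nlinarith, Or.inr ?_⟩
    by_contra! hcon
    nlinarith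

lemma div_one_add_le_one_sub_pow {α : ℝ} (hα0 : 0 ≤ α) (hα1 : α ≤ 1) (g : ℕ) :
    α * g / (1 + α * g) ≤ 1 - (1 - α) ^ g := by
  have h1 : 1 + (g : ℝ) * α ≤ (1 + α) ^ g := one_add_mul_le_pow (by linarith) g
  have h2 : (1 - α) ^ g * (1 + α) ^ g ≤ 1 := by
    rw [← mul_pow]
    exact pow_le_one₀ (by nlinarith) (by nlinarith)
  have h3 : 0 ≤ (1 - α) ^ g := pow_nonneg (by linarith) g
  have h4 : 0 ≤ α * g := by positivity
  rw [div_le_iff₀ (by linarith)]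
  nlinarith [mul_le_mul_of_nonneg_left h1 h3]

lemma le_missBound_exponent {α δ p p' M : ℝ} {l m s : ℕ} (hα0 : 0 ≤ α) (hα1 : α ≤ 1) (hδ0 : 0 ≤ δ)
    (hδ1 : δ < 1) (hp : 0 ≤ p) (hpp : (1 - δ) * p ≤ p') (hM : 0 < M)
    (hms : (1 - δ) * l ≤ (m : ℝ) * s) (h : m = 1 ∨ M ≤ s * p') :
    (1 - δ) ^ 4 * (α * l * p) / (1 + α * l * p / M)
      ≤ (1 - (1 - α) ^ ⌈(1 - δ) * m⌉₊) * ((1 - δ) * s) * p' := by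
  have hd : 0 < 1 - δ := by linarith
  have hp' : 0 ≤ p' := le_trans (by positivity) hpp
  set u := α * l * p with hu
  have hu0 : 0 ≤ u := by positivity
  have hv : (1 - δ) ^ 2 * u ≤ α * (m * s) * p' := by
    calc (1 - δ) ^ 2 * u = α * ((1 - δ) * l) * ((1 - δ) * p) := by rw [hu]; ring
      _ ≤ _ := by gcongr
  rcases h with rfl | h
  · have hg : ⌈(1 - δ) * ((1 : ℕ) : ℝ)⌉₊ = 1 := by
      rw [Nat.ceil_eq_iff one_ne_zero]; norm_num; constructor <;> linarith
    rw [hg, pow_one]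
    have h1 : (1 - δ) ^ 4 * u / (1 + u / M) ≤ (1 - δ) ^ 4 * u :=
      div_le_self (by positivity) (by linarith [div_nonneg hu0 hM.le])
    have h2 : (1 - δ) ^ 4 * u ≤ (1 - δ) ^ 3 * u := by
      have : (1 - δ) ^ 4 ≤ (1 - δ) ^ 3 := pow_le_pow_of_le_one hd.le (by linarith) (by norm_num)
      gcongr
    have h3 : (1 - δ) * ((1 - δ) ^ 2 * u) ≤ (1 - δ) * (α * ((1 : ℕ) * s) * p') := by gcongr
    push_cast at h3
    nlinarith
  · set g := ⌈(1 - δ) * (m : ℝ)⌉₊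
    set A := α * g
    have hA0 : 0 ≤ A := by positivity
    have hA : α * ((1 - δ) * m) ≤ A := mul_le_mul_of_nonneg_left (Nat.le_ceil _) hα0
    set b := (s : ℝ) * p' with hb
    have hb0 : 0 < b := by linarith
    set v := (1 - δ) ^ 3 * u with hvdef
    have hv0 : 0 ≤ v := by positivity
    have hvA : v ≤ b * A := by
      calc v = (1 - δ) * ((1 - δ) ^ 2 * u) := by rw [hvdef]; ring
        _ ≤ (1 - δ) * (α * (m * s) * p') := by gcongr
        _ = b * (α * ((1 - δ) * m)) := by rw [hb]; ring
        _ ≤ b * A := by gcongr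
    have hvu : v ≤ u := by
      have : (1 - δ) ^ 3 ≤ 1 := pow_le_one₀ hd.le (by linarith)
      nlinarith
    have key : v / (1 + u / M) ≤ b * (A / (1 + A)) := by
      rw [← mul_div_assoc, div_le_div_iff₀ (by positivity) (by positivity)]
      have h1 : v * A ≤ b * A * (u / M) := by
        have : v / M ≤ u / M := by gcongr
        have h2 : v ≤ b * (u / M) := by
          calc v = M * (v / M) := by field_simp
            _ ≤ b * (u / M) := by gcongr
        nlinarith
      nlinarith
    calc _ = (1 - δ) * (v / (1 + u / M)) := by rw [hvdef]; ring
      _ ≤ (1 - δ) * (b * (1 - (1 - α) ^ g)) := by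
        have := div_one_add_le_one_sub_pow hα0 hα1 g
        gcongr
        exact key.trans (by gcongr)
      _ = _ := by rw [hb]; ring

/-- A union of `s` blocks of keys reaches a fresh key ring `M` times on average. -/
lemma le_mul_pEdge {P k K s : ℕ} {η M : ℝ} (hP : 0 < P) (hk1 : 1 ≤ k) (hk : k ≤ P) (hK : K ≤ P)
    (hM : 0 ≤ M) (hs : η * P / k / 4 ≤ s) (hs2 : 2 * M ≤ s) (hKη : 2 * M ≤ η * K / 4) :
    M ≤ s * pEdge P k K := by
  set z := (k : ℝ) * K / P with hz
  have hP0 : (0 : ℝ) < P := by exact_mod_cast hP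
  have hk0 : (0 : ℝ) < k := by exact_mod_cast hk1
  have hz0 : 0 ≤ z := by positivity
  have h1 := one_sub_exp_le_pEdge hk hK
  rw [← hz] at h1
  have h2 : exp (-z) ≤ 1 / (1 + z) := by
    rw [exp_neg, ← one_div]
    gcongr
    linarith [add_one_le_exp z]
  have hsz : 2 * M ≤ s * z := by
    calc 2 * M ≤ η * K / 4 := hKη
      _ = η * P / k / 4 * z := by rw [hz]; field_simp
      _ ≤ s * z := by gcongr
  have h3 : M ≤ s * (1 - 1 / (1 + z)) := by
    rw [show 1 - 1 / (1 + z) = z / (1 + z) by field_simp; ring, ← mul_div_assoc,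
      le_div_iff₀ (by linarith)]
    rcases le_total z 1 with h | h <;> nlinarith
  refine h3.trans ?_
  gcongr
  linarith

lemma overlap_term_le {n l m s k P : ℕ} {δ σ : ℝ} (hδ0 : 0 < δ) (hδ1 : δ ≤ 1 / 2) (hσ : 0 < σ)
    (hPn : σ * n ≤ P) (hl : 1 ≤ l) (hm : 1 ≤ m) (hs : 1 ≤ s) (hk : 1 ≤ k) (hmsl : m * s ≤ l)
    (hms : (1 - δ) * l ≤ (m : ℝ) * s) (hsk : (s * k : ℕ) ≤ exp (-(2 / δ)) * P)
    (hδk : 8 ≤ δ ^ 2 * k) :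
    0 ≤ (s * k : ℕ) * (δ * log ((P : ℝ) / (s * k : ℕ)) - 1) ∧
    (n.choose l : ℝ) * (2 ^ m *
        exp (-((s * k : ℕ) * (δ * log ((P : ℝ) / (s * k : ℕ)) - 1) * δ * m)))
      ≤ (2 * exp 1 / σ * (k * exp (-(δ ^ 2 / 8) * k))) ^ l := by
  set w : ℝ := ((s * k : ℕ) : ℝ) with hw
  have hs0 : (0 : ℝ) < s := by exact_mod_cast hs
  have hk0 : (0 : ℝ) < k := by exact_mod_cast hk
  have hl0 : (0 : ℝ) < l := by exact_mod_cast hl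
  have hwe : w = s * k := by rw [hw]; push_cast; ring
  have hw0 : 0 < w := by rw [hwe]; positivity
  have hP0 : (0 : ℝ) < P := by
    by_contra! h
    nlinarith [exp_pos (-(2 / δ))]
  set L := log ((P : ℝ) / w) with hL
  have hL2 : 2 / δ ≤ L := by
    rw [hL, le_log_iff_exp_le (by positivity), le_div_iff₀ hw0]
    calc exp (2 / δ) * w ≤ exp (2 / δ) * (exp (-(2 / δ)) * P) := by gcongr
      _ = P := by rw [← mul_assoc, ← exp_add]; simp
  have hδL : 2 ≤ δ * L := by rw [div_le_iff₀ hδ0] at hL2; linarith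
  have hL1 : 1 ≤ L := by nlinarith
  have hexpL : exp L = P / w := exp_log (by positivity)
  refine ⟨by nlinarith, ?_⟩
  have hms2 : (l : ℝ) / 2 ≤ m * s := by nlinarith
  have hm0 : (0 : ℝ) < m := by exact_mod_cast hm
  have hexpo : l * (δ ^ 2 * k * L / 4) ≤ w * (δ * L - 1) * δ * m := by
    calc l * (δ ^ 2 * k * L / 4) = l / 2 * (δ ^ 2 * k * L / 2) := by ring
      _ ≤ m * s * (δ ^ 2 * k * L / 2) := by gcongr
      _ = w * (δ * L / 2) * δ * m := by rw [hwe]; ring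
      _ ≤ _ := by gcongr; linarith
  have hchoose : (n.choose l : ℝ) ≤ (exp 1 * (k * exp L / σ)) ^ l := by
    refine (choose_le_exp_mul hl).trans ?_
    rw [mul_pow, ← exp_nat_mul, mul_one]
    refine mul_le_mul_of_nonneg_left (pow_le_pow_left₀ (by positivity) ?_ l) (exp_pos _).le
    rw [hexpL, hwe, div_le_div_iff₀ hl0 hσ]
    have hsl : (s : ℝ) ≤ l := by exact_mod_cast (Nat.le_mul_of_pos_left s hm).trans hmsl
    have h1 : (k : ℝ) * (P / (s * k)) * l = P * (l / s) := by field_simp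
    rw [h1]
    have : 1 ≤ (l : ℝ) / s := by rwa [le_div_iff₀ hs0, one_mul]
    nlinarith
  have h2m : (2 : ℝ) ^ m ≤ 2 ^ l :=
    pow_le_pow_right₀ (by norm_num) ((Nat.le_mul_of_pos_right m hs).trans hmsl)
  calc _ ≤ (exp 1 * (k * exp L / σ)) ^ l * (2 ^ l * exp (-(l * (δ ^ 2 * k * L / 4)))) := by
        gcongr
    _ = (2 * exp 1 / σ * (k * exp (L - δ ^ 2 * k * L / 4))) ^ l := by
        rw [show -(l * (δ ^ 2 * k * L / 4)) = (l : ℝ) * (-(δ ^ 2 * k * L / 4)) by ring, exp_nat_mul,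
          ← mul_pow, ← mul_pow, sub_eq_add_neg, exp_add]
        ring
    _ ≤ _ := by
        gcongr
        nlinarith

section MissTerm

variable {ι : Type*} [Fintype ι] {μ u w : ι → ℝ} {δ : ℝ}

lemma sum_mul_exp_neg_le_of_small (hμ : ∀ i, 0 ≤ μ i) (hμ1 : ∑ i, μ i = 1) (hδ0 : 0 ≤ δ)
    (hδ1 : δ < 1) (hu0 : ∀ j, 0 ≤ u j) (hu : ∀ j, u j ≤ δ)
    (hw : ∀ j, (1 - δ) ^ 4 * u j / (1 + u j / 20) ≤ w j) :
    ∑ j, μ j * exp (-w j) ≤ 1 - (1 - δ) ^ 6 * ∑ j, μ j * u j := by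
  suffices h : ∀ j, μ j * exp (-w j) ≤ μ j - (1 - δ) ^ 6 * (μ j * u j) by
    refine (Finset.sum_le_sum fun j _ => h j).trans_eq ?_
    rw [Finset.sum_sub_distrib, hμ1, Finset.mul_sum]
  intro j
  have hd : 0 < 1 - δ := by linarith
  have huj := hu0 j
  have hδu := hu j
  set y := (1 - δ) ^ 5 * u j with hy
  have hy0 : 0 ≤ y := by positivity
  have hyδ : y ≤ δ := by
    have : (1 - δ) ^ 5 ≤ 1 := pow_le_one₀ hd.le (by linarith)
    nlinarith
  have hyw : y ≤ w j := by
    refine le_trans ?_ (hw j)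
    rw [le_div_iff₀ (by positivity)]
    have h1 : (1 - δ) * (1 + u j / 20) ≤ 1 := by nlinarith
    calc y * (1 + u j / 20) = (1 - δ) ^ 4 * u j * ((1 - δ) * (1 + u j / 20)) := by rw [hy]; ring
      _ ≤ (1 - δ) ^ 4 * u j * 1 := by gcongr
      _ = _ := mul_one _
  have hexp : exp (-w j) ≤ 1 - (1 - δ) * y := by
    calc exp (-w j) ≤ exp (-y) := by gcongr
      _ ≤ 1 / (1 + y) := by
        rw [exp_neg, ← one_div]
        gcongr
        linarith [add_one_le_exp y]
      _ ≤ _ := by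
        rw [div_le_iff₀ (by linarith)]
        have : 0 ≤ y * (δ - (1 - δ) * y) := mul_nonneg hy0 (by nlinarith)
        linarith
  calc μ j * exp (-w j) ≤ μ j * (1 - (1 - δ) * y) := mul_le_mul_of_nonneg_left hexp (hμ j)
    _ = _ := by rw [hy]; ring

lemma sum_mul_exp_neg_le_of_exists {μ₀ a : ℝ} (hμ0 : ∀ i, 0 ≤ μ i) (hμ1 : ∑ i, μ i = 1)
    (ha : 0 ≤ a) (hw0 : ∀ j, 0 ≤ w j) {j : ι} (hμj : μ₀ ≤ μ j) (hj : a ≤ w j) :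
    ∑ j, μ j * exp (-w j) ≤ 1 - μ₀ * (1 - exp (-a)) := by
  classical
  have h : ∑ i, μ i * (1 - exp (-w i)) = 1 - ∑ i, μ i * exp (-w i) := by
    simp only [mul_sub, mul_one, Finset.sum_sub_distrib, hμ1]
  have h1 : μ j * (1 - exp (-w j)) ≤ ∑ i, μ i * (1 - exp (-w i)) := by
    refine Finset.single_le_sum (f := fun i => μ i * (1 - exp (-w i))) (fun i _ => ?_)
      (Finset.mem_univ j)
    have : exp (-w i) ≤ 1 := exp_le_one_iff.2 (by linarith [hw0 i])
    exact mul_nonneg (hμ0 i) (by linarith)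
  have h2 : exp (-w j) ≤ exp (-a) := by gcongr
  have h3 : exp (-a) ≤ 1 := exp_le_one_iff.2 (by linarith)
  have h4 : μ₀ * (1 - exp (-a)) ≤ μ j * (1 - exp (-w j)) := by
    have := hμ0 j
    calc _ ≤ μ j * (1 - exp (-a)) := mul_le_mul_of_nonneg_right hμj (by linarith)
      _ ≤ _ := by gcongr
  linarith

lemma pow_le_exp_neg_mul {x q : ℝ} (hx : 0 ≤ x) (h : x ≤ 1 - q) (t : ℕ) :
    x ^ t ≤ exp (-(q * t)) := by
  calc x ^ t ≤ exp (-q) ^ t := pow_le_pow_left₀ hx (h.trans (one_sub_le_exp_neg q)) t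
    _ = _ := by rw [← exp_nat_mul]; ring_nf

lemma choose_le_exp_of_small {n l : ℕ} {t x : ℝ} (ht0 : 0 < t) (ht1 : t < 1)
    (hx : x * log (1 / t) ≤ t) (hl : (l : ℝ) ≤ x * n) : (n.choose l : ℝ) ≤ exp (2 * t * n) := by
  have hlog : 0 ≤ log (1 / t) := log_nonneg (by rw [le_div_iff₀ ht0]; linarith)
  rcases lt_or_ge n l with h | h
  · rw [Nat.choose_eq_zero_of_lt h]; simpa using (exp_pos _).le
  have h1 : (n.choose l : ℝ) * t ^ l ≤ (t + 1) ^ n := by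
    rw [add_pow]
    refine le_trans (le_of_eq ?_) (Finset.single_le_sum
      (f := fun i => t ^ i * 1 ^ (n - i) * (n.choose i : ℝ)) (fun i _ => by positivity)
      (Finset.mem_range.2 (Nat.lt_succ_of_le h)))
    simp [mul_comm]
  have h2 : (t + 1) ^ n ≤ exp (t * n) := by
    calc (t + 1) ^ n ≤ exp t ^ n := by gcongr; exact add_one_le_exp t
      _ = _ := by rw [← exp_nat_mul]; ring_nf
  have h3 : (1 / t) ^ l ≤ exp (t * n) := by
    have : (1 / t) ^ l = exp (l * log (1 / t)) := by
      rw [exp_nat_mul, exp_log (by positivity)]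
    rw [this, exp_le_exp]
    calc (l : ℝ) * log (1 / t) ≤ x * n * log (1 / t) := by gcongr
      _ = x * log (1 / t) * n := by ring
      _ ≤ t * n := by gcongr
  calc (n.choose l : ℝ) = (n.choose l : ℝ) * t ^ l * (1 / t) ^ l := by
        rw [mul_assoc, ← mul_pow, mul_one_div_cancel ht0.ne', one_pow, mul_one]
    _ ≤ exp (t * n) * exp (t * n) := by gcongr; exact h1.trans h2
    _ = _ := by rw [← exp_add]; ring_nf

lemma choose_mul_pow_le_of_small {n l : ℕ} {κ V S : ℝ} (hκ0 : 0 < κ) (hκ1 : κ ≤ 1)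
    (hδ : δ = κ / 50) (hn : 1 ≤ log n) (hl : l ≤ n) (hV : (1 + κ) * log n ≤ n * V)
    (hlV : l * V ≤ δ) (hS0 : 0 ≤ S) (hS : S ≤ 1 - (1 - δ) ^ 6 * (l * V)) :
    (n.choose l : ℝ) * S ^ (n - l) ≤ exp (-(κ / 2) * log n) ^ l := by
  have hδ0 : 0 < δ := by rw [hδ]; positivity
  have hδ1 : δ ≤ 1 / 50 := by rw [hδ]; linarith
  have hd : 0 < 1 - δ := by linarith
  have hn0 : (0 : ℝ) < n := by
    rcases Nat.eq_zero_or_pos n with rfl | h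
    · norm_num at hn
    · exact_mod_cast h
  have hlogn : 0 ≤ log (n : ℝ) := by linarith
  have hl0 : (0 : ℝ) ≤ l := Nat.cast_nonneg l
  have hV0 : 0 ≤ V := by
    have : 0 ≤ n * V := le_trans (by positivity) hV
    exact nonneg_of_mul_nonneg_right this hn0
  have hpow := pow_le_exp_neg_mul hS0 hS (n - l)
  rw [Nat.cast_sub hl] at hpow
  have hlδ : (l : ℝ) ≤ δ * n := by
    calc (l : ℝ) ≤ l * ((1 + κ) * log n) := by
          refine le_mul_of_one_le_right hl0 ?_
          nlinarith
      _ ≤ l * (n * V) := by gcongr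
      _ = l * V * n := by ring
      _ ≤ δ * n := by gcongr
  have h7 : 1 - 7 * δ ≤ (1 - δ) ^ 7 := by
    have := one_add_mul_le_pow (a := -δ) (by linarith) 7
    rw [← sub_eq_add_neg] at this
    push_cast at this
    linarith
  have h8 : 1 + κ / 2 ≤ (1 - δ) ^ 7 * (1 + κ) := by
    refine le_trans ?_ (mul_le_mul_of_nonneg_right h7 (by linarith))
    rw [hδ]
    nlinarith
  have hmain : (1 + κ / 2) * (l * log n) ≤ (1 - δ) ^ 6 * (l * V) * (n - l) := by
    calc (1 + κ / 2) * (l * log n) ≤ (1 - δ) ^ 7 * (1 + κ) * (l * log n) := by gcongr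
      _ = (1 - δ) ^ 7 * l * ((1 + κ) * log n) := by ring
      _ ≤ (1 - δ) ^ 7 * l * (n * V) := by gcongr
      _ = (1 - δ) ^ 6 * (l * V) * ((1 - δ) * n) := by ring
      _ ≤ _ := by gcongr; linarith
  have hch : (n.choose l : ℝ) ≤ exp (l * log n) := by
    rw [exp_nat_mul, exp_log hn0]
    exact_mod_cast Nat.choose_le_pow n l
  calc _ ≤ exp (l * log n) * exp (-((1 - δ) ^ 6 * (l * V) * (n - l))) := by gcongr
    _ = exp (l * log n - (1 - δ) ^ 6 * (l * V) * (n - l)) := by rw [← exp_add]; ring_nf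
    _ ≤ exp (l * (-(κ / 2) * log n)) := by
        rw [exp_le_exp]
        linarith
    _ = _ := exp_nat_mul _ _

lemma choose_mul_pow_le_of_intermediate {n l : ℕ} {q x S : ℝ} (hq0 : 0 < q) (hq1 : q ≤ 1)
    (hx : x * log (1 / (q / 8)) ≤ q / 8) (hl : 2 * l ≤ n) (hlx : (l : ℝ) ≤ x * n) (hS0 : 0 ≤ S)
    (hS : S ≤ 1 - q) : (n.choose l : ℝ) * S ^ (n - l) ≤ exp (-(q / 4) * n) := by
  have hpow := pow_le_exp_neg_mul hS0 hS (n - l)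
  have hln : (2 : ℝ) * l ≤ n := by exact_mod_cast hl
  rw [Nat.cast_sub (by omega)] at hpow
  have hch := choose_le_exp_of_small (by positivity) (by linarith) hx hlx
  calc _ ≤ exp (2 * (q / 8) * n) * exp (-(q * (n - l))) := by gcongr
    _ = exp (2 * (q / 8) * n - q * (n - l)) := by rw [← exp_add]; ring_nf
    _ ≤ _ := by
        rw [exp_le_exp]
        nlinarith

lemma choose_mul_pow_le_of_large {n l : ℕ} {S : ℝ} (hl : 2 * l ≤ n) (hS0 : 0 ≤ S)
    (hS : S ≤ 1 / 16) : (n.choose l : ℝ) * S ^ (n - l) ≤ (1 / 2) ^ n := by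
  calc _ ≤ (2 : ℝ) ^ n * (1 / 16) ^ (n - l) := by
        gcongr
        exact_mod_cast Nat.choose_le_two_pow n l
    _ = 2 ^ n * (1 / 4) ^ (2 * (n - l)) := by rw [pow_mul]; norm_num
    _ ≤ 2 ^ n * (1 / 4) ^ n := by
        refine mul_le_mul_of_nonneg_left ?_ (by positivity)
        exact pow_le_pow_of_le_one (by norm_num) (by norm_num) (by omega)
    _ = _ := by rw [← mul_pow]; norm_num

lemma sum_mul_exp_neg_le_of_large (hμ : ∀ i, 0 ≤ μ i) (hμ1 : ∑ i, μ i = 1)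
    (hw : ∀ j, 5 ≤ w j) : ∑ j, μ j * exp (-w j) ≤ 1 / 16 := by
  have h5 : exp (-5) ≤ (1 : ℝ) / 16 := by
    have h2 : (2 : ℝ) ≤ exp 1 := by linarith [add_one_le_exp (1 : ℝ)]
    rw [exp_neg, ← one_div]
    apply one_div_le_one_div_of_le (by norm_num)
    calc (16 : ℝ) ≤ 2 ^ 5 := by norm_num
      _ ≤ exp 1 ^ 5 := by gcongr
      _ = exp 5 := by rw [← exp_nat_mul]; norm_num
  calc _ ≤ ∑ j, μ j * (1 / 16) := by
        refine Finset.sum_le_sum fun j _ => mul_le_mul_of_nonneg_left (le_trans ?_ h5) (hμ j)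
        rw [exp_le_exp]
        linarith [hw j]
    _ = 1 / 16 := by rw [← Finset.sum_mul, hμ1, one_mul]

/-- The three regimes of component sizes: up to order `n / log n`, up to a small multiple of `n`,
and beyond. -/
lemma choose_mul_sum_mul_exp_neg_pow_le {v : ι → ℝ} {n l : ℕ} {κ μ₀ q x : ℝ} (hμ : ∀ i, 0 ≤ μ i)
    (hμ1 : ∑ i, μ i = 1) (hμ₀ : 0 < μ₀) (hμ₀i : ∀ i, μ₀ ≤ μ i) (hμ₀1 : μ₀ ≤ 1) (hκ0 : 0 < κ)
    (hκ1 : κ ≤ 1) (hδ : δ = κ / 50) (hq : q = μ₀ * (1 - exp (-(δ * μ₀ / 4))))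
    (hx : x * log (1 / (q / 8)) ≤ q / 8) (hn : 1 ≤ log n) (hl : 2 * l ≤ n) (hv0 : ∀ j, 0 ≤ v j)
    (hv : (1 + κ) * log n ≤ n * ∑ j, μ j * v j) (hvx : ∀ j, 20 ≤ x * (n * v j))
    (hw : ∀ j, (1 - δ) ^ 4 * (l * v j) / (1 + l * v j / 20) ≤ w j) :
    (n.choose l : ℝ) * (∑ j, μ j * exp (-w j)) ^ (n - l)
      ≤ exp (-(κ / 2) * log n) ^ l + exp (-(q / 4) * n) + (1 / 2) ^ n := by
  have hδ0 : 0 < δ := by rw [hδ]; positivity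
  have hδ1 : δ ≤ 1 / 50 := by rw [hδ]; linarith
  have hlv0 : ∀ j, 0 ≤ (l : ℝ) * v j := fun j => mul_nonneg (Nat.cast_nonneg l) (hv0 j)
  have hρ : (1 : ℝ) / 2 ≤ (1 - δ) ^ 4 := by
    have := one_add_mul_le_pow (a := -δ) (by linarith) 4
    rw [← sub_eq_add_neg] at this
    push_cast at this
    linarith
  have hw' : ∀ j, l * v j / 2 / (1 + l * v j / 20) ≤ w j := fun j => by
    refine le_trans ?_ (hw j)
    have := hlv0 j
    gcongr
    nlinarith
  have hw0 : ∀ j, 0 ≤ w j := fun j => by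
    refine le_trans ?_ (hw' j)
    have := hlv0 j
    positivity
  have hS0 : 0 ≤ ∑ j, μ j * exp (-w j) :=
    Finset.sum_nonneg fun j _ => mul_nonneg (hμ j) (exp_pos _).le
  have hexp1 : 0 ≤ exp (-(κ / 2) * log n) ^ l := by positivity
  have hexp2 : 0 ≤ exp (-(q / 4) * n) := by positivity
  have hexp3 : (0 : ℝ) ≤ (1 / 2) ^ n := by positivity
  have hsum : ∑ j, μ j * (l * v j) = l * ∑ j, μ j * v j := by
    rw [Finset.mul_sum]
    exact Finset.sum_congr rfl fun j _ => by ring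
  rcases le_or_gt (∑ j, μ j * (l * v j)) (δ * μ₀) with hc | hc
  · have hu : ∀ j, (l : ℝ) * v j ≤ δ := by
      intro j
      have h1 : μ j * (l * v j) ≤ ∑ j, μ j * (l * v j) :=
        Finset.single_le_sum (f := fun j => μ j * (l * v j))
          (fun i _ => mul_nonneg (hμ i) (hlv0 i)) (Finset.mem_univ j)
      have h2 : μ₀ * (l * v j) ≤ μ₀ * δ := by
        have := mul_le_mul_of_nonneg_right (hμ₀i j) (hlv0 j)
        linarith
      exact le_of_mul_le_mul_left h2 hμ₀
    have hS := sum_mul_exp_neg_le_of_small hμ hμ1 hδ0.le (by linarith) hlv0 hu hw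
    rw [hsum] at hS hc
    have := choose_mul_pow_le_of_small hκ0 hκ1 hδ hn (by omega) hv
      (hc.trans (mul_le_of_le_one_right hδ0.le hμ₀1)) hS0 hS
    linarith
  rcases le_or_gt (l : ℝ) (x * n) with hlx | hlx
  · obtain ⟨j, hj⟩ : ∃ j, δ * μ₀ < l * v j := by
      by_contra! h
      have : ∑ j, μ j * (l * v j) ≤ ∑ j, μ j * (δ * μ₀) :=
        Finset.sum_le_sum fun j _ => mul_le_mul_of_nonneg_left (h j) (hμ j)
      rw [← Finset.sum_mul, hμ1, one_mul] at this
      linarith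
    have hwj : δ * μ₀ / 4 ≤ w j := by
      refine le_trans ?_ (hw' j)
      have h1 := hlv0 j
      have h2 : δ * μ₀ ≤ 1 := by nlinarith
      rw [le_div_iff₀ (by positivity)]
      nlinarith [mul_pos hδ0 hμ₀]
    have hS := sum_mul_exp_neg_le_of_exists hμ hμ1 (by positivity) hw0 (hμ₀i j) hwj
    rw [← hq] at hS
    have hqexp : exp (-(δ * μ₀ / 4)) < 1 := by
      rw [exp_lt_one_iff]
      linarith [mul_pos hδ0 hμ₀]
    have hq0 : 0 < q := by rw [hq]; exact mul_pos hμ₀ (by linarith)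
    have hq1 : q ≤ 1 := by
      rw [hq]
      nlinarith [exp_pos (-(δ * μ₀ / 4))]
    have := choose_mul_pow_le_of_intermediate hq0 hq1 hx hl hlx hS0 hS
    linarith
  · have hw5 : ∀ j, 5 ≤ w j := by
      intro j
      have h20 : 20 ≤ (l : ℝ) * v j := by
        have := mul_le_mul_of_nonneg_right hlx.le (hv0 j)
        linarith [hvx j]
      refine le_trans ?_ (hw' j)
      rw [le_div_iff₀ (by positivity)]
      linarith
    have := choose_mul_pow_le_of_large hl hS0 (sum_mul_exp_neg_le_of_large hμ hμ1 hw5)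
    linarith

end MissTerm

lemma Pr_not_conn_le_sum_explicit {n r P k : ℕ} {μ : Fin r → ℝ} {K : Fin r → ℕ} {p : Fin r → ℝ}
    {α σ δ κ μ₀ q x : ℝ} (hμ1 : ∑ i, μ i = 1) (hμ₀ : 0 < μ₀) (hμ₀i : ∀ i, μ₀ ≤ μ i)
    (hμ₀1 : μ₀ ≤ 1) (hκ0 : 0 < κ) (hκ1 : κ ≤ 1) (hδ : δ = κ / 50)
    (hq : q = μ₀ * (1 - exp (-(δ * μ₀ / 4)))) (hx : x * log (1 / (q / 8)) ≤ q / 8)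
    (hσ : 0 < σ) (hα0 : 0 ≤ α) (hα1 : α ≤ 1) (hK : ∀ j, K j ≤ P) (hPn : σ * n ≤ P)
    (hk1 : 1 ≤ k) (hkK : ∀ j, k ≤ K j) (hkP : 200 / δ ≤ exp (-(2 / δ)) * P / k)
    (hδk : 8 ≤ δ ^ 2 * k) (hKη : ∀ j, 40 ≤ exp (-(2 / δ)) * K j / 4) (hp0 : ∀ j, 0 ≤ p j)
    (hp : ∀ j, (1 - δ) * p j ≤ pEdge P k (K j)) (hn : 1 ≤ log n)
    (hΛ : (1 + κ) * log n ≤ n * ∑ j, μ j * (α * p j)) (hpx : ∀ j, 20 ≤ x * (n * (α * p j))) :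
    Pr μ K α (fun cfg : Config n r P => ¬ conn cfg)
      ≤ ∑ l ∈ Finset.Icc 1 (n / 2), ((2 * exp 1 / σ * (k * exp (-(δ ^ 2 / 8) * k))) ^ l
        + (exp (-(κ / 2) * log n) ^ l + exp (-(q / 4) * n) + (1 / 2) ^ n)) := by
  have hδ0 : 0 < δ := by rw [hδ]; positivity
  have hδ1 : δ ≤ 1 / 50 := by rw [hδ]; linarith
  have hμ : ∀ i, 0 ≤ μ i := fun i => hμ₀.le.trans (hμ₀i i)
  have hk0 : (0 : ℝ) < k := by exact_mod_cast hk1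
  have hP0 : 0 < P := by
    rcases Nat.eq_zero_or_pos P with rfl | h
    · have : 0 < 200 / δ := by positivity
      norm_num at hkP
      linarith
    · exact h
  have hη1 : exp (-(2 / δ)) ≤ 1 := exp_le_one_iff.2 (neg_nonpos.2 (by positivity))
  have hkP' : k ≤ P := by
    rcases isEmpty_or_nonempty (Fin r) with h | ⟨⟨j⟩⟩
    · simp at hμ1
    · exact (hkK j).trans (hK j)
  set f : ℕ → ℝ := fun l => (2 * exp 1 / σ * (k * exp (-(δ ^ 2 / 8) * k))) ^ l
        + (exp (-(κ / 2) * log n) ^ l + exp (-(q / 4) * n) + (1 / 2) ^ n) with hf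
  have hch : ∀ l ∈ Finset.Icc 1 (n / 2), (0 : ℝ) < n.choose l := by
    intro l hl
    rw [Finset.mem_Icc] at hl
    exact_mod_cast Nat.choose_pos (by omega)
  refine (Pr_not_conn_le hμ hμ1 hK hα0 hα1 (fun l => f l / n.choose l) ?_).trans
    (Finset.sum_le_sum fun l hl => (mul_div_cancel₀ _ (hch l hl).ne').le)
  intro l hl1 hl2
  have hc := hch l (Finset.mem_Icc.2 ⟨hl1, by omega⟩)
  obtain ⟨m, s, hm, hs, hmsl, hsR, hms, hor⟩ :=
    exists_block_sizes hδ0 (by linarith) hkP hl1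
  refine ⟨m, s, hmsl, ?_⟩
  have hsk : ((s * k : ℕ) : ℝ) ≤ exp (-(2 / δ)) * P := by
    push_cast
    rwa [le_div_iff₀ hk0] at hsR
  have hskP : s * k ≤ P := by
    have : ((s * k : ℕ) : ℝ) ≤ P :=
      hsk.trans (mul_le_of_le_one_left (Nat.cast_nonneg P) hη1)
    exact_mod_cast this
  obtain ⟨hB0, hterm⟩ := overlap_term_le hδ0 (by linarith) hσ hPn hl1 hm hs hk1 hmsl hms hsk hδk
  have hmiss := sum_missProb_pow_le hμ hμ1 (fun j => hk1.trans (hkK j)) hK hk1 hkK hkP' hm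
    hα0 hα1 (by linarith) hB0 (by rw [exp_le_exp]; linarith) hδ0.le hs hskP (n - l)
  have hw : ∀ j, (1 - δ) ^ 4 * (l * (α * p j)) / (1 + l * (α * p j) / 20)
      ≤ (1 - (1 - α) ^ ⌈(1 - δ) * m⌉₊) * ((1 - δ) * s) * pEdge P k (K j) := by
    intro j
    have h := le_missBound_exponent (M := 20) hα0 hα1 hδ0.le (by linarith) (hp0 j) (hp j)
      (by norm_num) hms (hor.imp_right fun h => ?_)
    · rwa [show (l : ℝ) * (α * p j) = α * l * p j by ring]
    · refine le_mul_pEdge hP0 hk1 hkP' (hK j) (by norm_num) h ?_ ?_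
      · have : 40 ≤ 200 / δ / 4 := by
          rw [div_div, le_div_iff₀ (by positivity)]
          linarith
        linarith
      · linarith [hKη j]
  have hmain := choose_mul_sum_mul_exp_neg_pow_le hμ hμ1 hμ₀ hμ₀i hμ₀1 hκ0 hκ1 hδ hq hx hn hl2
    (fun j => mul_nonneg hα0 (hp0 j)) hΛ hpx hw
  rw [le_div_iff₀ hc, mul_comm]
  refine (mul_le_mul_of_nonneg_left hmiss hc.le).trans ?_
  rw [mul_add]
  exact add_le_add hterm hmain

lemma sum_Icc_pow_le {a : ℝ} (ha0 : 0 ≤ a) (ha : a ≤ 1 / 2) (N : ℕ) :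
    ∑ l ∈ Finset.Icc 1 N, a ^ l ≤ 2 * a := by
  have h : ∀ N : ℕ, ∑ l ∈ Finset.Icc 1 N, a ^ l ≤ 2 * a - 2 * a ^ (N + 1) := by
    intro N
    induction N with
    | zero => simp
    | succ N ih =>
      rw [Finset.sum_Icc_succ_top (by omega), pow_succ a (N + 1)]
      nlinarith [pow_nonneg ha0 (N + 1)]
  linarith [h N, pow_nonneg ha0 (N + 1)]

lemma pEdge_le_pEdge_right {P a k K : ℕ} (hkK : k ≤ K) (hK : K ≤ P) (ha : a ≤ P) :
    pEdge P a k ≤ pEdge P a K := by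
  obtain ⟨A, -, hA⟩ := Finset.exists_subset_card_eq (s := (Finset.univ : Finset (Fin P)))
    (by simpa using ha)
  have h := sum_keyWeight_antitone hkK hK
    (f := fun s => if Disjoint A s then (1 : ℝ) else 0) (by
      intro s t hst
      dsimp only
      split_ifs with h1 h2 h2
      · rfl
      · exact absurd (h1.mono_right hst) h2
      · exact zero_le_one
      · rfl)
  rw [sum_keyWeight_disjoint, sum_keyWeight_disjoint, hA] at h
  linarith

lemma one_sub_mul_pEdge_le_min {P k₁ K : ℕ} {δ τ : ℝ} (hδ0 : 0 ≤ δ) (hδ1 : δ ≤ 1) (hk : k₁ ≤ K)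
    (hK : K ≤ P) (hτ : 2 ≤ τ * P) (hτδ : exp (-(τ ^ 2 / 4 * P)) ≤ δ) :
    (1 - δ) * pEdge P k₁ K ≤ pEdge P (min k₁ ⌊τ * P⌋₊) K := by
  have h0 := pEdge_nonneg P k₁ K
  have h1 := pEdge_le_one P k₁ K
  rcases le_total k₁ ⌊τ * P⌋₊ with h | h
  · rw [min_eq_left h]
    nlinarith
  · rw [min_eq_right h]
    have hP0 : (0 : ℝ) < P := by
      rcases Nat.eq_zero_or_pos P with rfl | h
      · norm_num at hτ
      · exact_mod_cast h
    have hfl : τ * P / 2 ≤ (⌊τ * P⌋₊ : ℝ) := by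
      have := Nat.lt_floor_add_one (τ * P)
      linarith
    have hflK : τ * P / 2 ≤ (K : ℝ) := hfl.trans (by exact_mod_cast h.trans hk)
    have h2 := one_sub_exp_le_pEdge ((h.trans hk).trans hK) hK
    have h3 : τ ^ 2 / 4 * P ≤ (⌊τ * P⌋₊ : ℝ) * K / P := by
      rw [le_div_iff₀ hP0]
      calc τ ^ 2 / 4 * P * P = (τ * P / 2) * (τ * P / 2) := by ring
        _ ≤ _ := by gcongr
    have h4 : exp (-((⌊τ * P⌋₊ : ℝ) * K / P)) ≤ exp (-(τ ^ 2 / 4 * P)) := by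
      rw [exp_le_exp]
      linarith
    have h5 : (1 - δ) * pEdge P k₁ K ≤ 1 - δ := by nlinarith
    linarith

lemma tendsto_mul_exp_neg_mul_atTop {b : ℝ} (hb : 0 < b) :
    Tendsto (fun x : ℝ => x * exp (-b * x)) atTop (nhds 0) := by
  simpa using tendsto_rpow_mul_exp_neg_mul_atTop_nhds_zero 1 b hb

end HetKey

/-- one-law for connectivity: if `Λ_1(n) = c_n log n / n` with
`c_n → c`, `c > 1`, and additionally `P_n ≥ σ n` for some `σ > 0` and
`n ⬝ α_n ⬝ p_{11}(n) → ∞`, then the probability that `G(n; μ, K_n, P_n, α_n)`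
is connected tends to `1`. -/
theorem connectivity_one_law
    (r : ℕ) (hr : 0 < r)
    (μ : Fin r → ℝ) (hμpos : ∀ i, 0 < μ i) (hμsum : ∑ i, μ i = 1)
    (K : ℕ → Fin r → ℕ) (Pn : ℕ → ℕ) (α : ℕ → ℝ)
    (hα0 : ∀ n, 0 < α n) (hα1 : ∀ n, α n < 1)
    (hK1 : ∀ n i, 1 ≤ K n i)
    (hKmono : ∀ n, Monotone (K n))
    (hKP : ∀ n i, 2 * K n i ≤ Pn n)
    (cn : ℕ → ℝ) (c : ℝ)
    (hcn : Tendsto cn atTop (nhds c)) (hc : 1 < c)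
    (hΛ : ∀ n, 2 ≤ n →
      Lam μ (K n) (Pn n) (α n) ⟨0, hr⟩ = cn n * Real.log n / n)
    (σ : ℝ) (hσ : 0 < σ) (hPn : ∀ n, σ * n ≤ (Pn n : ℝ))
    (hp11 : Tendsto
      (fun n : ℕ => (n : ℝ) * α n * pEdge (Pn n) (K n ⟨0, hr⟩) (K n ⟨0, hr⟩))
      atTop atTop) :
    Tendsto
      (fun n => Pr (n := n) (P := Pn n) μ (K n) (α n) (fun cfg => conn cfg))
      atTop (nhds 1) := by
  obtain ⟨κ, hκ0, hκ1, hκc⟩ : ∃ κ : ℝ, 0 < κ ∧ κ ≤ 1 ∧ 1 + κ < c :=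
    ⟨min 1 ((c - 1) / 2), lt_min one_pos (by linarith), min_le_left _ _, by
      linarith [min_le_right 1 ((c - 1) / 2)]⟩
  obtain ⟨μ₀, hμ₀, hμ₀i, hμ₀1⟩ : ∃ μ₀ : ℝ, 0 < μ₀ ∧ (∀ i, μ₀ ≤ μ i) ∧ μ₀ ≤ 1 := by
    obtain ⟨i, -, hi⟩ := Finset.exists_min_image Finset.univ μ ⟨⟨0, hr⟩, Finset.mem_univ _⟩
    refine ⟨μ i, hμpos i, fun j => hi j (Finset.mem_univ j), hμsum ▸ ?_⟩
    exact Finset.single_le_sum (fun j _ => (hμpos j).le) (Finset.mem_univ i)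
  obtain ⟨δ, hδ⟩ : ∃ δ : ℝ, δ = κ / 50 := ⟨_, rfl⟩
  have hδ0 : 0 < δ := by rw [hδ]; positivity
  obtain ⟨η, hη⟩ : ∃ η : ℝ, η = exp (-(2 / δ)) := ⟨_, rfl⟩
  have hη0 : 0 < η := hη ▸ exp_pos _
  obtain ⟨τ, hτ⟩ : ∃ τ : ℝ, τ = δ * η / 200 := ⟨_, rfl⟩
  have hτ0 : 0 < τ := by rw [hτ]; positivity
  obtain ⟨q, hq⟩ : ∃ q : ℝ, q = μ₀ * (1 - exp (-(δ * μ₀ / 4))) := ⟨_, rfl⟩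
  have hqe : exp (-(δ * μ₀ / 4)) < 1 := by
    rw [exp_lt_one_iff]
    linarith [mul_pos hδ0 hμ₀]
  have hq0 : 0 < q := by rw [hq]; exact mul_pos hμ₀ (by linarith)
  have hq1 : q ≤ 1 := by
    rw [hq]
    nlinarith [exp_pos (-(δ * μ₀ / 4))]
  obtain ⟨x, hx0, hx⟩ : ∃ x : ℝ, 0 < x ∧ x * log (1 / (q / 8)) ≤ q / 8 := by
    have : 0 < log (1 / (q / 8)) := log_pos (by rw [lt_div_iff₀ (by positivity)]; linarith)
    exact ⟨q / 8 / log (1 / (q / 8)), by positivity, (div_mul_cancel₀ _ this.ne').le⟩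
  set i₀ : Fin r := ⟨0, hr⟩ with hi₀
  have hKle : ∀ n j, K n j ≤ Pn n := fun n j => by have := hKP n j; omega
  have hK0 : ∀ n j, K n i₀ ≤ K n j := fun n j => hKmono n (Fin.mk_le_of_le_val (Nat.zero_le _))
  have hn : Tendsto (fun n : ℕ => (n : ℝ)) atTop atTop := tendsto_natCast_atTop_atTop
  have hP : Tendsto (fun n => (Pn n : ℝ)) atTop atTop :=
    tendsto_atTop_mono hPn (hn.const_mul_atTop hσ)
  have hKt : Tendsto (fun n => (K n i₀ : ℝ)) atTop atTop := by
    have hsq : Tendsto (fun n => (K n i₀ : ℝ) ^ 2) atTop atTop := by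
      refine tendsto_atTop_mono (fun n => ?_) (hp11.const_mul_atTop hσ)
      have hP0 : (0 : ℝ) < Pn n := by exact_mod_cast (hK1 n i₀).trans (hKle n i₀)
      have h1 := pEdge_le_mul_div (hK1 n i₀) (hKle n i₀) (hKle n i₀)
      rw [le_div_iff₀ hP0] at h1
      have h2 := pEdge_nonneg (Pn n) (K n i₀) (K n i₀)
      have h3 := (hα0 n).le
      calc σ * (n * α n * pEdge (Pn n) (K n i₀) (K n i₀))
          = pEdge (Pn n) (K n i₀) (K n i₀) * (σ * n) * α n := by ring
        _ ≤ pEdge (Pn n) (K n i₀) (K n i₀) * (σ * n) * 1 := by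
          gcongr
          exact (hα1 n).le
        _ ≤ pEdge (Pn n) (K n i₀) (K n i₀) * Pn n * 1 := by
          gcongr
          exact hPn n
        _ ≤ (K n i₀ : ℝ) ^ 2 := by linarith [sq (K n i₀ : ℝ)]
    refine tendsto_atTop.2 fun b => (hsq.eventually_ge_atTop (b ^ 2)).mono fun n h => ?_
    exact le_of_sq_le_sq h (Nat.cast_nonneg _)
  obtain ⟨k, hk⟩ : ∃ k : ℕ → ℕ, ∀ n, k n = min (K n i₀) ⌊τ * Pn n⌋₊ := ⟨_, fun n => rfl⟩
  have hkt : Tendsto (fun n => (k n : ℝ)) atTop atTop := by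
    refine tendsto_natCast_atTop_iff.2 (tendsto_atTop.2 fun b => ?_)
    filter_upwards [hKt.eventually_ge_atTop b, (hP.const_mul_atTop hτ0).eventually_ge_atTop b]
      with n h1 h2
    rw [hk]
    exact le_min (by exact_mod_cast h1) (Nat.le_floor h2)
  have ha : Tendsto (fun n => 2 * exp 1 / σ * (k n * exp (-(δ ^ 2 / 8) * k n))) atTop (nhds 0) := by
    simpa using ((tendsto_mul_exp_neg_mul_atTop (by positivity : 0 < δ ^ 2 / 8)).comp hkt).const_mul
      (2 * exp 1 / σ)
  have hb : Tendsto (fun n : ℕ => exp (-(κ / 2) * log n)) atTop (nhds 0) :=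
    tendsto_exp_atBot.comp
      ((tendsto_log_atTop.comp hn).const_mul_atTop_of_neg (by linarith : -(κ / 2) < 0))
  have hcq : Tendsto (fun n : ℕ => n * exp (-(q / 4) * n)) atTop (nhds 0) :=
    (tendsto_mul_exp_neg_mul_atTop (by positivity : 0 < q / 4)).comp hn
  have hd : Tendsto (fun n : ℕ => n * (1 / 2 : ℝ) ^ n) atTop (nhds 0) :=
    tendsto_self_mul_const_pow_of_lt_one (by norm_num) (by norm_num)
  have hev : ∀ᶠ n in atTop, Pr μ (K n) (α n) (fun cfg : Config n r (Pn n) => ¬ conn cfg)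
      ≤ 2 * (2 * exp 1 / σ * (k n * exp (-(δ ^ 2 / 8) * k n))) + (2 * exp (-(κ / 2) * log n)
        + n * exp (-(q / 4) * n) + n * (1 / 2 : ℝ) ^ n) := by
    filter_upwards [eventually_ge_atTop 2, hcn.eventually_const_le hκc,
      hkt.eventually_ge_atTop 1, hkt.eventually_ge_atTop (8 / δ ^ 2),
      hKt.eventually_ge_atTop (160 / η), (tendsto_log_atTop.comp hn).eventually_ge_atTop 1,
      hp11.eventually_ge_atTop (20 / x), (hP.const_mul_atTop hτ0).eventually_ge_atTop 2,
      (tendsto_exp_neg_atTop_nhds_zero.comp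
        (hP.const_mul_atTop (by positivity : 0 < τ ^ 2 / 4))).eventually_le_const hδ0,
      ha.eventually_le_const (by norm_num : (0 : ℝ) < 1 / 2),
      hb.eventually_le_const (by norm_num : (0 : ℝ) < 1 / 2)]
      with n hn2 hcn' hk1 hk8 hK160 hlog hp20 hτP hτδ ha' hb'
    have hn0 : (0 : ℝ) < n := by exact_mod_cast (by omega : 0 < n)
    have hk1' : 1 ≤ k n := by exact_mod_cast hk1
    have hk0 : (0 : ℝ) < k n := by linarith
    have hkτ : (k n : ℝ) ≤ τ * Pn n := by
      refine le_trans ?_ (Nat.floor_le (by linarith : 0 ≤ τ * Pn n))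
      rw [hk]
      exact_mod_cast min_le_right _ _
    have hkK : ∀ j, k n ≤ K n j := fun j => by
      rw [hk]
      exact (min_le_left _ _).trans (hK0 n j)
    have hΛn : n * ∑ j, μ j * (α n * pEdge (Pn n) (K n i₀) (K n j)) = cn n * log n := by
      have h := hΛ n hn2
      rw [Lam, lam, eq_div_iff hn0.ne', Finset.mul_sum] at h
      rw [← h, mul_comm]
      congr 1
      exact Finset.sum_congr rfl fun j _ => by ring
    refine (Pr_not_conn_le_sum_explicit (k := k n)
      (p := fun j => pEdge (Pn n) (K n i₀) (K n j)) hμsum hμ₀ hμ₀i hμ₀1 hκ0 hκ1 hδ hq hx hσ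
      (hα0 n).le (hα1 n).le (hKle n) (hPn n) hk1' hkK ?_ ?_ ?_ (fun j => pEdge_nonneg _ _ _)
      ?_ hlog ?_ ?_).trans ?_
    · rw [← hη, div_le_div_iff₀ hδ0 hk0]
      rw [hτ] at hkτ
      linarith
    · rw [div_le_iff₀ (by positivity)] at hk8
      linarith
    · intro j
      rw [← hη]
      have h1 : (K n i₀ : ℝ) ≤ K n j := by exact_mod_cast hK0 n j
      rw [div_le_iff₀ hη0] at hK160
      nlinarith
    · intro j
      rw [hk]
      exact one_sub_mul_pEdge_le_min hδ0.le (by rw [hδ]; linarith) (hK0 n j) (hKle n j) hτP hτδ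
    · rw [hΛn]
      have hlog0 : 0 ≤ log (n : ℝ) := zero_le_one.trans hlog
      gcongr
    · intro j
      have h1 := pEdge_le_pEdge_right (hK0 n j) (hKle n j) (hKle n i₀)
      rw [div_le_iff₀ hx0] at hp20
      have h2 := (hα0 n).le
      calc (20 : ℝ) ≤ n * α n * pEdge (Pn n) (K n i₀) (K n i₀) * x := hp20
        _ ≤ n * α n * pEdge (Pn n) (K n i₀) (K n j) * x := by gcongr
        _ = _ := by ring
    · have hcard : (((n / 2 : ℕ) : ℝ)) ≤ n := by exact_mod_cast Nat.div_le_self n 2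
      simp only [Finset.sum_add_distrib, Finset.sum_const, Nat.card_Icc, nsmul_eq_mul,
        Nat.add_sub_cancel]
      gcongr
      · exact sum_Icc_pow_le (by positivity) ha' _
      · exact sum_Icc_pow_le (exp_pos _).le hb' _
  have hnot : Tendsto (fun n => Pr μ (K n) (α n) (fun cfg : Config n r (Pn n) => ¬ conn cfg)) atTop
      (nhds 0) := by
    refine tendsto_of_tendsto_of_tendsto_of_le_of_le' tendsto_const_nhds ?_
      (Eventually.of_forall fun n =>
        Pr_nonneg (fun i => (hμpos i).le) (hα0 n).le (hα1 n).le _) hev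
    simpa using (ha.const_mul 2).add (((hb.const_mul 2).add hcq).add hd)
  simp_rw [fun n => one_sub_Pr_not (α := α n) hμsum (hKle n)
    (fun cfg : Config n r (Pn n) => conn cfg)]
  simpa using hnot.const_sub 1
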